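/- arXiv:1805.10237 — 3 statements merged into one kernel-verified Lean document; each statement's English description precedes it below -/
import Mathlib

section
/- (r-fold van Kampen–Flores theorem for prime powers.) Let r be a prime power (r = q^m for a prime q and integer m ≥ 1) and k a positive integer. For every continuous map f from the standard simplex Δ_{(kr+2)(r−1)} = stdSimplex ℝ (Fin ((k*r+2)*(r−1)+1)) to EuclideanSpace ℝ (Fin (k*r)) there exist r pairwise disjoint subsets A₁, …, A_r ⊆ Fin ((k*r+2)*(r−1)+1), each of cardinality k(r−1)+1 (so the corresponding faces are k(r−1)-dimensional), such that the images under f of the faces spanned by A₁, …, A_r have a common point: the intersection over s of f '' {x : ∀ i ∉ A_s, x i = 0} is nonempty. -/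
namespace VanKampenFlores

open Finsupp

section Chains

variable (R : Type*) [CommRing R] {X Y : Type*}

/-- Augmented ordered chains on the full simplex with vertex set `X`. -/
abbrev Chain (X : Type*) := List X →₀ R

/-- The boundary of an ordered simplex. -/
noncomputable def bdList : List X → Chain R X
  | [] => 0
  | x :: l => single l 1 - Finsupp.lmapDomain R R (List.cons x) (bdList l)

/-- The boundary operator on ordered chains. -/
noncomputable def bd : Chain R X →ₗ[R] Chain R X := Finsupp.linearCombination R (bdList R)

/-- The cone operator prepending the vertex `x`. -/
noncomputable def cone (x : X) : Chain R X →ₗ[R] Chain R X :=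
  Finsupp.lmapDomain R R (List.cons x)

/-- The chain map induced by a map of vertices. -/
noncomputable def push (f : X → Y) : Chain R X →ₗ[R] Chain R Y :=
  Finsupp.lmapDomain R R (List.map f)

@[simp] lemma bd_single (l : List X) (r : R) : bd R (single l r) = r • bdList R l := by
  simp [bd]

@[simp] lemma cone_single (x : X) (l : List X) (r : R) :
    cone R x (single l r) = single (x :: l) r := by
  simp [cone]

@[simp] lemma push_single (f : X → Y) (l : List X) (r : R) :
    push R f (single l r) = single (l.map f) r := by
  simp [push]

@[simp] lemma bdList_nil : bdList R ([] : List X) = 0 := rfl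

lemma bdList_cons (x : X) (l : List X) :
    bdList R (x :: l) = single l 1 - cone R x (bdList R l) := rfl

lemma bd_cone (x : X) (c : Chain R X) : bd R (cone R x c) = c - cone R x (bd R c) := by
  induction c using Finsupp.induction_linear with
  | zero => simp
  | add f g hf hg => simp only [map_add, hf, hg]; abel
  | single l r => simp [bdList_cons, smul_sub]

lemma push_cone (f : X → Y) (x : X) (c : Chain R X) :
    push R f (cone R x c) = cone R (f x) (push R f c) := by
  induction c using Finsupp.induction_linear with
  | zero => simp
  | add f g hf hg => simp only [map_add, hf, hg]
  | single l r => simp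

lemma push_bd (f : X → Y) (c : Chain R X) : push R f (bd R c) = bd R (push R f c) := by
  induction c using Finsupp.induction_linear with
  | zero => simp
  | add f g hf hg => simp only [map_add, hf, hg]
  | single l r =>
    simp only [bd_single, push_single, map_smul]
    congr 1
    induction l with
    | nil => simp
    | cons x l ih => simp [bdList_cons, push_cone, ih]

/-- The prism operator between two vertex maps, on an ordered simplex. -/
noncomputable def prismList (f g : X → Y) : List X → Chain R Y
  | [] => 0
  | x :: l => single (f x :: g x :: l.map g) 1 - cone R (f x) (prismList f g l)

/-- The prism operator between two vertex maps. -/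
noncomputable def prism (f g : X → Y) : Chain R X →ₗ[R] Chain R Y :=
  Finsupp.linearCombination R (prismList R f g)

@[simp] lemma prism_single (f g : X → Y) (l : List X) (r : R) :
    prism R f g (single l r) = r • prismList R f g l := by
  simp [prism]

lemma prism_cone (f g : X → Y) (x : X) (c : Chain R X) :
    prism R f g (cone R x c) =
      cone R (f x) (cone R (g x) (push R g c)) - cone R (f x) (prism R f g c) := by
  induction c using Finsupp.induction_linear with
  | zero => simp
  | add f g hf hg => simp only [map_add, hf, hg]; abel
  | single l r => simp [prismList, smul_sub]

lemma bd_prism (f g : X → Y) (c : Chain R X) :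
    bd R (prism R f g c) = push R g c - push R f c - prism R f g (bd R c) := by
  induction c using Finsupp.induction_linear with
  | zero => simp
  | add f g hf hg => simp only [map_add, hf, hg]; abel
  | single l r =>
    have key : bd R (prismList R f g l) =
        push R g (single l 1) - push R f (single l 1) - prism R f g (bdList R l) := by
      induction l with
      | nil => simp [prismList]
      | cons x l ih =>
        simp only [prismList, map_sub, bd_cone, ih, bdList_cons, prism_cone, push_single,
          List.map_cons, prism_single, one_smul, bd_single, cone_single]
        have := push_bd R g (single l 1)
        simp only [bd_single, push_single, one_smul] at this
        rw [this]
        abel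
    have h1 : ∀ h : X → Y, push R h (single l r) = r • push R h (single l 1) := fun h ↦ by simp
    rw [prism_single, map_smul, key, h1 g, h1 f, bd_single, map_smul, smul_sub, smul_sub]

end Chains

section Action

variable (R : Type*) [CommRing R] {G X : Type*} [AddCommGroup G] [AddAction G X]

/-- The action of the group algebra on ordered chains. -/
noncomputable def act : AddMonoidAlgebra R G →ₐ[R] Module.End R (Chain R X) :=
  AddMonoidAlgebra.lift R (Module.End R (Chain R X)) G
    { toFun := fun g ↦ push R (g.toAdd +ᵥ ·)
      map_one' := by
        ext1 l
        ext1
        simp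
      map_mul' := fun g h ↦ by
        ext1 l
        ext1
        simp only [LinearMap.comp_apply, Finsupp.lsingle_apply, push_single, Module.End.mul_apply,
          List.map_map, Function.comp_def, toAdd_mul, add_vadd] }

@[simp] lemma act_single (g : G) (r : R) (c : Chain R X) :
    act R (AddMonoidAlgebra.single g r) c = r • push R (g +ᵥ ·) c := by
  simp [act]

lemma bd_act (D : AddMonoidAlgebra R G) (c : Chain R X) :
    bd R (act R D c) = act R D (bd R c) := by
  induction D using AddMonoidAlgebra.induction_linear with
  | zero => simp
  | add f g hf hg => simp [hf, hg]
  | single l r => simp [push_bd]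

/-- The differentials of the standard periodic resolution of a cyclic group with generator `s`
of order `p`. -/
noncomputable def coef (p : ℕ) (s : G) (n : ℕ) : AddMonoidAlgebra R G :=
  if n = 0 then 0
  else if Odd n then AddMonoidAlgebra.single s 1 - 1
  else ∑ j ∈ Finset.range p, AddMonoidAlgebra.single s 1 ^ j

variable {R}

lemma coef_mul_coef {p : ℕ} {s : G} (hs : p • s = 0) (n : ℕ) :
    coef R p s n * coef R p s (n - 1) = 0 := by
  have h1 : (AddMonoidAlgebra.single s (1 : R)) ^ p = 1 := by
    rw [AddMonoidAlgebra.single_pow, hs]; simp [AddMonoidAlgebra.one_def]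
  unfold coef
  rcases Nat.eq_zero_or_pos n with h | h
  · simp [h]
  rcases Nat.even_or_odd n with h2 | h2
  · have h3 : Odd (n - 1) := by
      rw [Nat.odd_sub h]; simp [h2]
    have h4 : n - 1 ≠ 0 := by rintro h; simp [h] at h3
    rw [if_neg h.ne', if_neg (by simpa using h2), if_neg h4, if_pos h3, geom_sum_mul, h1, sub_self]
  · have h3 : ¬ Odd (n - 1) := by
      rw [Nat.odd_sub h]; simp [h2]
    rw [if_neg h.ne', if_pos h2]
    split_ifs
    · simp
    · rw [mul_geom_sum, h1, sub_self]

variable {m : ℕ} (p : ℕ) (s : Fin m → G)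

variable (R) in
/-- The signed coefficients of the total differential of a tensor product of `m` periodic
resolutions. -/
noncomputable def wt (i : Fin m) (a : Fin m →₀ ℕ) : AddMonoidAlgebra R G :=
  (-1) ^ (∑ k ∈ Finset.univ.filter (· < i), a k) * coef R p (s i) (a i)

/-- The total differential applied to a family of chains. -/
noncomputable def delta (c : (Fin m →₀ ℕ) → Chain R X) (a : Fin m →₀ ℕ) : Chain R X :=
  ∑ i, act R (wt R p s i a) (c (a - single i 1))

variable {p s}

lemma wt_eq_zero {i : Fin m} {a : Fin m →₀ ℕ} (h : a i = 0) : wt R p s i a = 0 := by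
  simp [wt, coef, h]

lemma wt_mul_self (hs : ∀ i, p • s i = 0) (i : Fin m) (a : Fin m →₀ ℕ) :
    wt R p s i a * wt R p s i (a - single i 1) = 0 := by
  unfold wt
  rw [mul_mul_mul_comm]
  simp [coef_mul_coef (hs i)]

lemma sign_swap {i j : Fin m} (hij : i < j) {a : Fin m →₀ ℕ} (hi : a i ≠ 0) :
    ∑ k ∈ Finset.univ.filter (· < j), a k =
      ∑ k ∈ Finset.univ.filter (· < j), (a - single i 1 : Fin m →₀ ℕ) k + 1 := by
  have h1 : i ∈ Finset.univ.filter (· < j) := by simpa using hij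
  rw [← Finset.add_sum_erase _ _ h1, ← Finset.add_sum_erase _ (fun k ↦ (a - single i 1 : Fin m →₀ ℕ) k) h1]
  have : ∑ x ∈ (Finset.univ.filter (· < j)).erase i, (a - single i 1 : Fin m →₀ ℕ) x =
      ∑ x ∈ (Finset.univ.filter (· < j)).erase i, a x := by
    refine Finset.sum_congr rfl fun x hx ↦ ?_
    have : i ≠ x := (Finset.ne_of_mem_erase hx).symm
    simp [this]
  rw [this]
  simp
  omega

lemma sign_same {i j : Fin m} (hij : ¬ i < j) {a : Fin m →₀ ℕ} :
    ∑ k ∈ Finset.univ.filter (· < j), (a - single i 1 : Fin m →₀ ℕ) k =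
      ∑ k ∈ Finset.univ.filter (· < j), a k := by
  refine Finset.sum_congr rfl fun x hx ↦ ?_
  have : i ≠ x := by
    rintro rfl
    simp at hx
    exact hij hx
  simp [this]

/-- The signs and the operators of two distinct directions, in the two possible orders. -/
lemma sign_anticomm {i j : Fin m} (hij : i < j) {a : Fin m →₀ ℕ} (hi : a i ≠ 0) (S : Type*)
    [CommRing S] :
    ((-1 : S) ^ (∑ k ∈ Finset.univ.filter (· < i), a k)) *
      (-1) ^ (∑ k ∈ Finset.univ.filter (· < j), (a - single i 1 : Fin m →₀ ℕ) k) =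
    - (((-1) ^ (∑ k ∈ Finset.univ.filter (· < j), a k)) *
      (-1) ^ (∑ k ∈ Finset.univ.filter (· < i), (a - single j 1 : Fin m →₀ ℕ) k)) := by
  rw [sign_same hij.not_gt, sign_swap hij hi, pow_succ]
  ring

lemma coef_sub_single {i j : Fin m} (hij : i ≠ j) (a : Fin m →₀ ℕ) :
    coef R p (s j) ((a - single i 1 : Fin m →₀ ℕ) j) = coef R p (s j) (a j) := by
  simp [hij]

lemma wt_mul_comm_of_lt {i j : Fin m} (hij : i < j) (a : Fin m →₀ ℕ) :
    wt R p s i a * wt R p s j (a - single i 1) + wt R p s j a * wt R p s i (a - single j 1) = 0 := by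
  by_cases hi : a i = 0
  · rw [wt_eq_zero hi, wt_eq_zero (i := i) (a := a - single j 1)]
    · simp
    · simp [hi]
  unfold wt
  rw [coef_sub_single hij.ne, coef_sub_single hij.ne', mul_mul_mul_comm, sign_anticomm hij hi]
  ring

lemma wt_mul_comm {i j : Fin m} (hij : i ≠ j) (a : Fin m →₀ ℕ) :
    wt R p s i a * wt R p s j (a - single i 1) + wt R p s j a * wt R p s i (a - single j 1) = 0 := by
  rcases lt_or_gt_of_ne hij with h | h
  · exact wt_mul_comm_of_lt h a
  · rw [add_comm]; exact wt_mul_comm_of_lt h a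

/-- A double sum with cancelling off-diagonal terms equals its diagonal part. -/
lemma sum_sum_eq_diag {M : Type*} [AddCommGroup M] (T : Fin m → Fin m → M)
    (hT : ∀ i j, i ≠ j → T i j + T j i = 0) : ∑ i, ∑ j, T i j = ∑ i, T i i := by
  have h1 : ∀ i, ∑ j, T i j = T i i + ∑ j, if i = j then 0 else T i j := by
    intro i
    rw [← Finset.add_sum_erase _ _ (Finset.mem_univ i),
      ← Finset.add_sum_erase _ (fun j ↦ if i = j then 0 else T i j) (Finset.mem_univ i)]
    simp only [if_true, zero_add]
    congr 1
    refine Finset.sum_congr rfl fun j hj ↦ ?_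
    rw [if_neg (Finset.ne_of_mem_erase hj).symm]
  simp only [h1, Finset.sum_add_distrib, add_eq_left]
  rw [← Finset.sum_product']
  refine Finset.sum_involution (fun x _ ↦ x.swap) ?_ ?_ (by simp) (by simp)
  · rintro ⟨i, j⟩ -
    by_cases h : i = j
    · simp [h]
    · simp [h, Ne.symm h, hT i j h]
  · rintro ⟨i, j⟩ - h
    have : i ≠ j := by
      rintro rfl
      simp at h
    simp [this.symm]

lemma delta_delta (hs : ∀ i, p • s i = 0) (c : (Fin m →₀ ℕ) → Chain R X) (a : Fin m →₀ ℕ) :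
    delta p s (delta p s c) a = 0 := by
  unfold delta
  simp only [map_sum, ← Module.End.mul_apply, ← map_mul]
  rw [sum_sum_eq_diag]
  · simp [wt_mul_self hs]
  · intro i j hij
    have h : a - single j 1 - single i 1 = a - single i 1 - single j 1 := tsub_right_comm
    rw [h, ← LinearMap.add_apply, ← map_add, wt_mul_comm hij]
    simp

lemma bd_delta (c : (Fin m →₀ ℕ) → Chain R X) (a : Fin m →₀ ℕ) :
    bd R (delta p s c a) = delta p s (fun b ↦ bd R (c b)) a := by
  simp [delta, bd_act]

lemma delta_sub (c d : (Fin m →₀ ℕ) → Chain R X) (a : Fin m →₀ ℕ) :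
    delta p s (fun b ↦ c b - d b) a = delta p s c a - delta p s d a := by
  simp [delta]

lemma delta_zero (a : Fin m →₀ ℕ) :
    delta p s (fun _ ↦ (0 : Chain R X)) a = 0 := by
  simp [delta]

variable (p s) in
/-- The family of chains obtained from a point by iterating the total differential and the
contractions `C n`. -/
noncomputable def fam (C : ℕ → Chain R X →ₗ[R] Chain R X) (x : X) :
    ℕ → (Fin m →₀ ℕ) → Chain R X
  | 0, a => if a = 0 then single [x] 1 else 0
  | n + 1, a => C n (delta p s (fam C x n) a)

/-- A linear functional killed by the differentials of the periodic resolution. -/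
def Kills (p : ℕ) (s : Fin m → G) {M : Type*} [AddCommGroup M] [Module R M]
    (w : Chain R X →ₗ[R] M) : Prop :=
  ∀ i n c, w (act R (coef R p (s i) n) c) = 0

lemma Kills.delta {M : Type*} [AddCommGroup M] [Module R M] {w : Chain R X →ₗ[R] M}
    (hw : Kills p s w) (c : (Fin m →₀ ℕ) → Chain R X) (a : Fin m →₀ ℕ) :
    w (delta p s c a) = 0 := by
  unfold VanKampenFlores.delta wt
  rw [map_sum]
  refine Finset.sum_eq_zero fun i _ ↦ ?_
  rw [mul_comm, map_mul, Module.End.mul_apply]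
  exact hw _ _ _

lemma kills_of_invariant (hp : (p : R) = 0) {M : Type*} [AddCommGroup M] [Module R M]
    {w : Chain R X →ₗ[R] M} (hw : ∀ (g : G) c, w (push R (g +ᵥ ·) c) = w c) : Kills p s w := by
  intro i n c
  have h1 : ∀ j : ℕ, w (act R (AddMonoidAlgebra.single (s i) 1 ^ j) c) = w c := by
    intro j
    rw [AddMonoidAlgebra.single_pow, act_single]
    simp [hw]
  unfold coef
  split_ifs
  · simp
  · simp [hw]
  · rw [map_sum, LinearMap.sum_apply, map_sum]
    simp only [h1]
    rw [Finset.sum_const, Finset.card_range, ← Nat.cast_smul_eq_nsmul R, hp, zero_smul]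

lemma act_coef_nil (hp : (p : R) = 0) (i : Fin m) (n : ℕ) (r : R) :
    act R (coef R p (s i) n) (single ([] : List X) r) = 0 := by
  have : Kills (X := X) p s ((Finsupp.lsingle ([] : List X)).comp
      (Finsupp.lapply (R := R) (M := R) ([] : List X))) := by
    apply kills_of_invariant hp
    intro g c
    simp only [LinearMap.comp_apply]
    congr 1
    induction c using Finsupp.induction_linear with
    | zero => simp
    | add f g hf hg => simp only [map_add, hf, hg]
    | single l r => cases l <;> simp
  have h2 := this i n (single [] r)
  rw [LinearMap.comp_apply] at h2
  have h3 : ∀ D : AddMonoidAlgebra R G, Finsupp.lsingle (R := R) (M := R) ([] : List X)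
      (Finsupp.lapply (R := R) (M := R) ([] : List X) (act R D (single [] r))) =
      act R D (single ([] : List X) r) := by
    intro D
    induction D using AddMonoidAlgebra.induction_linear with
    | zero => simp
    | add f g hf hg => rw [map_add, LinearMap.add_apply, map_add, map_add, hf, hg]
    | single l r => simp
  rwa [h3] at h2

variable {C : ℕ → Chain R X →ₗ[R] Chain R X}

lemma bd_fam_succ (hs : ∀ i, p • s i = 0) (hp : (p : R) = 0)
    (hC : ∀ n b, bd R b = 0 → bd R (C n b) = b) (x : X) (n : ℕ) (a : Fin m →₀ ℕ) :
    bd R (fam p s C x (n + 1) a) = delta p s (fam p s C x n) a := by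
  induction n generalizing a with
  | zero =>
    refine hC _ _ ?_
    rw [bd_delta]
    unfold delta wt
    refine Finset.sum_eq_zero fun i _ ↦ ?_
    rw [map_mul, Module.End.mul_apply]
    have : act R (coef R p (s i) (a i)) (bd R (fam p s C x 0 (a - single i 1))) = 0 := by
      unfold fam
      split_ifs
      · rw [bd_single, bdList_cons]
        simp [act_coef_nil hp]
      · simp
    rw [this, map_zero]
  | succ n ih =>
    refine hC _ _ ?_
    rw [bd_delta]
    simp only [ih]
    exact delta_delta hs _ _

lemma bd_cone_of_cycle (x : X) (b : Chain R X) (hb : bd R b = 0) : bd R (cone R x b) = b := by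
  simp [bd_cone, hb]

variable (p s) in
/-- The chain homotopy comparing two families. -/
noncomputable def homot (x : X) (c : ℕ → (Fin m →₀ ℕ) → Chain R X) :
    ℕ → (Fin m →₀ ℕ) → Chain R X
  | 0, a => cone R x (c 0 a)
  | n + 1, a => cone R x (c (n + 1) a - delta p s (homot x c n) a)

lemma bd_homot_succ (hs : ∀ i, p • s i = 0) (x : X) (c : ℕ → (Fin m →₀ ℕ) → Chain R X)
    (h0 : ∀ a, bd R (c 0 a) = 0)
    (hc : ∀ n a, bd R (c (n + 1) a) = delta p s (c n) a) (n : ℕ) (a : Fin m →₀ ℕ) :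
    bd R (homot p s x c (n + 1) a) = c (n + 1) a - delta p s (homot p s x c n) a := by
  induction n generalizing a with
  | zero =>
    refine bd_cone_of_cycle _ _ ?_
    rw [map_sub, bd_delta, hc, ← delta_sub]
    convert delta_zero (p := p) (s := s) a using 2
    ext1 b
    simp [homot, bd_cone, h0]
  | succ n ih =>
    refine bd_cone_of_cycle _ _ ?_
    rw [map_sub, bd_delta, hc]
    simp only [ih]
    rw [delta_sub, delta_delta hs]
    simp

/-- An invariant cocycle takes the same value on any two families of chains. -/
lemma eval_fam_eq (hs : ∀ i, p • s i = 0) (hp : (p : R) = 0)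
    (hC : ∀ n b, bd R b = 0 → bd R (C n b) = b) {w : Chain R X →ₗ[R] R} (hw : Kills p s w)
    (hbd : ∀ c, w (bd R c) = 0) (x y : X) (n : ℕ) (a : Fin m →₀ ℕ) :
    w (fam p s C x n a) = w (fam p s (fun _ ↦ cone R y) y n a) := by
  rw [← sub_eq_zero, ← map_sub]
  set c : ℕ → (Fin m →₀ ℕ) → Chain R X := fun n a ↦
    fam p s C x n a - fam p s (fun _ ↦ cone R y) y n a with hcdef
  have h0 : ∀ a, bd R (c 0 a) = 0 := by
    intro a
    simp only [hcdef, fam]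
    split_ifs <;> simp [bdList_cons]
  have hc : ∀ n a, bd R (c (n + 1) a) = delta p s (c n) a := by
    intro n a
    rw [hcdef]
    simp only
    rw [map_sub, bd_fam_succ hs hp hC, bd_fam_succ hs hp (fun _ ↦ bd_cone_of_cycle y), ← delta_sub]
  change w (c n a) = 0
  cases n with
  | zero =>
    have : c 0 a = bd R (cone R x (c 0 a)) := by rw [bd_cone, h0]; simp
    rw [this, hbd]
  | succ n =>
    have := bd_homot_succ hs x c h0 hc n a
    rw [eq_sub_iff_add_eq] at this
    rw [← this, map_add, hbd, hw.delta, add_zero]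

end Action

section Cup

variable {R : Type*} [CommRing R] {G X κ : Type*}

/-- The cup product of a list of `2`-cochains, evaluated on an ordered simplex. -/
def cup (o : κ → X → X → X → R) : List κ → List X → R
  | [], [_] => 1
  | j :: L, x :: y :: z :: l => o j x y z * cup o L (z :: l)
  | _, _ => 0

/-- The cup product of a list of `2`-cochains, as a linear functional on chains. -/
noncomputable def cupL (o : κ → X → X → X → R) (L : List κ) : Chain R X →ₗ[R] R :=
  Finsupp.linearCombination R (cup o L)

@[simp] lemma cupL_single (o : κ → X → X → X → R) (L : List κ) (l : List X) (r : R) :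
    cupL o L (single l r) = r * cup o L l := by
  simp [cupL]

@[simp] lemma cup_cons (o : κ → X → X → X → R) (j : κ) (L : List κ) (x y z : X) (l : List X) :
    cup o (j :: L) (x :: y :: z :: l) = o j x y z * cup o L (z :: l) := by
  simp [cup]

@[simp] lemma cup_nil_singleton (o : κ → X → X → X → R) (x : X) : cup o [] [x] = 1 := by
  simp [cup]

@[simp] lemma cup_nil_cons (o : κ → X → X → X → R) (x y : X) (l : List X) :
    cup o [] (x :: y :: l) = 0 := by
  simp [cup]

@[simp] lemma cup_nil (o : κ → X → X → X → R) (L : List κ) : cup o L [] = 0 := by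
  simp [cup]

@[simp] lemma cup_cons_one (o : κ → X → X → X → R) (j : κ) (L : List κ) (x : X) :
    cup o (j :: L) [x] = 0 := by
  simp [cup]

@[simp] lemma cup_cons_two (o : κ → X → X → X → R) (j : κ) (L : List κ) (x y : X) :
    cup o (j :: L) [x, y] = 0 := by
  simp [cup]

lemma cupL_cone_three (o : κ → X → X → X → R) (j : κ) (L : List κ) (x y z : X)
    (c : Chain R X) :
    cupL o (j :: L) (cone R x (cone R y (cone R z c))) = o j x y z * cupL o L (cone R z c) := by
  induction c using Finsupp.induction_linear with
  | zero => simp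
  | add f g hf hg => simp only [map_add, hf, hg]; ring
  | single l r => simp; ring

lemma cupL_nil_cone_cone (o : κ → X → X → X → R) (x y : X) (c : Chain R X) :
    cupL o [] (cone R x (cone R y c)) = 0 := by
  induction c using Finsupp.induction_linear with
  | zero => simp
  | add f g hf hg => simp only [map_add, hf, hg]; ring
  | single l r => simp

/-- The cup product of cocycles is a cocycle. -/
lemma cup_bd (o : κ → X → X → X → R)
    (ho : ∀ j x y z w, o j y z w - o j x z w + o j x y w - o j x y z = 0) (L : List κ)
    (l : List X) : cupL o L (bdList R l) = 0 := by
  induction L generalizing l with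
  | nil =>
    match l with
    | [] => simp
    | [x] => simp [bdList_cons]
    | [x, y] => simp [bdList_cons]
    | x :: y :: z :: l =>
      simp only [bdList_cons, map_sub, cone_single, cupL_single, cupL_nil_cone_cone]
      simp
  | cons j L ih =>
    match l with
    | [] => simp
    | [x] => simp [bdList_cons]
    | [x, y] => simp [bdList_cons]
    | [x, y, z] => simp [bdList_cons]
    | x :: y :: z :: w :: l =>
      have h := ih (z :: w :: l)
      rw [bdList_cons, map_sub, sub_eq_zero] at h
      have h3 := cupL_cone_three o j L x y z (bdList R (w :: l))
      rw [← h] at h3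
      rw [bdList_cons R x, bdList_cons R y, bdList_cons R z]
      simp only [map_sub, cone_single, cupL_single, h3, cup_cons]
      linear_combination cup o L (w :: l) * ho j x y z w

lemma cupL_bd (o : κ → X → X → X → R)
    (ho : ∀ j x y z w, o j y z w - o j x z w + o j x y w - o j x y z = 0) (L : List κ)
    (c : Chain R X) : cupL o L (bd R c) = 0 := by
  induction c using Finsupp.induction_linear with
  | zero => simp
  | add f g hf hg => simp only [map_add, hf, hg]; ring
  | single l r => simp [cup_bd o ho L l]

/-- A cup product vanishes on every simplex on whose vertices one of its factors vanishes. -/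
lemma cup_eq_zero_of_mem (o : κ → X → X → X → R) {L : List κ} {l : List X} {j : κ} (hj : j ∈ L)
    (h : ∀ x ∈ l, ∀ y ∈ l, ∀ z ∈ l, o j x y z = 0) : cup o L l = 0 := by
  induction L generalizing l with
  | nil => simp at hj
  | cons i L ih =>
    match l with
    | [] => simp
    | [x] => simp
    | [x, y] => simp
    | x :: y :: z :: l =>
      rw [cup_cons]
      rcases List.mem_cons.1 hj with rfl | hj
      · rw [h x (by simp) y (by simp) z (by simp), zero_mul]
      · rw [ih hj, mul_zero]
        intro a ha b hb c hc
        exact h a (by simp at ha ⊢; tauto) b (by simp at hb ⊢; tauto) c (by simp at hc ⊢; tauto)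

variable [AddCommGroup G] [AddAction G X]

lemma cupL_push (o : κ → X → X → X → R)
    (ho : ∀ j (g : G) x y z, o j (g +ᵥ x) (g +ᵥ y) (g +ᵥ z) = o j x y z) (L : List κ) (g : G)
    (c : Chain R X) : cupL o L (push R (g +ᵥ ·) c) = cupL o L c := by
  have key : ∀ l : List X, cup o L (l.map (g +ᵥ ·)) = cup o L l := by
    induction L with
    | nil =>
      intro l
      match l with
      | [] => simp
      | [x] => simp
      | x :: y :: l => simp
    | cons j L ih =>
      intro l
      match l with
      | [] => simp
      | [x] => simp
      | [x, y] => simp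
      | x :: y :: z :: l =>
        have := ih (z :: l)
        simp only [List.map_cons, cup_cons, ho] at this ⊢
        rw [this]
  induction c using Finsupp.induction_linear with
  | zero => simp
  | add f g hf hg => simp only [map_add, hf, hg]
  | single l r => simp [key]

/-- The bilinear extension to the group algebra of a function of two group elements. -/
noncomputable def pairing (f : G → G → R) :
    AddMonoidAlgebra R G →ₗ[R] AddMonoidAlgebra R G →ₗ[R] R :=
  (Finsupp.linearCombination R fun h ↦ (Finsupp.linearCombination R (f h)).comp
    (AddMonoidAlgebra.coeffLinearEquiv (S := R) (M := G) R).toLinearMap).comp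
    (AddMonoidAlgebra.coeffLinearEquiv (S := R) (M := G) R).toLinearMap

omit [AddCommGroup G] in
@[simp] lemma pairing_single (f : G → G → R) (h h' : G) (r r' : R) :
    pairing f (AddMonoidAlgebra.single h r) (AddMonoidAlgebra.single h' r') = r * r' * f h h' := by
  simp [pairing, mul_assoc]

omit [AddCommGroup G] in
lemma pairing_comm {f : G → G → R} (hf : ∀ h h', f h h' = f h' h) (D E : AddMonoidAlgebra R G) :
    pairing f D E = pairing f E D := by
  induction D using AddMonoidAlgebra.induction_linear with
  | zero => simp
  | add D D' hD hD' => simp [hD, hD']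
  | single g r =>
    induction E using AddMonoidAlgebra.induction_linear with
    | zero => simp
    | add D D' hD hD' => simp [hD, hD']
    | single h r' => simp [hf g h]; ring

/-- The transition function of a `2`-cochain at a base point. -/
def transition (o : X → X → X → R) (x : X) (h h' : G) : R := o x (h +ᵥ x) ((h + h') +ᵥ x)

lemma cupL_cone_act (o : κ → X → X → X → R)
    (ho : ∀ j (g : G) x y z, o j (g +ᵥ x) (g +ᵥ y) (g +ᵥ z) = o j x y z) (j : κ) (L : List κ)
    (x : X) (D E : AddMonoidAlgebra R G) (c : Chain R X) :
    cupL o (j :: L) (cone R x (act R D (cone R x (act R E (cone R x c))))) =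
      pairing (transition (o j) x) D E * cupL o L (cone R x c) := by
  induction D using AddMonoidAlgebra.induction_linear with
  | zero => simp
  | add D D' hD hD' => simp only [map_add, LinearMap.add_apply, hD, hD', add_mul]
  | single g r =>
    induction E using AddMonoidAlgebra.induction_linear with
    | zero => simp
    | add D D' hD hD' => simp only [map_add, LinearMap.add_apply, hD, hD', add_mul]
    | single h r' =>
      rw [act_single, act_single]
      simp only [map_smul, push_cone, cupL_cone_three, pairing_single, smul_eq_mul]
      have h1 := cupL_push o ho L g (push R (h +ᵥ ·) (cone R x c))
      rw [cupL_push o ho L h, push_cone, push_cone] at h1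
      rw [h1, transition, add_vadd]
      ring

variable {m : ℕ} {p : ℕ} {s : Fin m → G}

lemma wt_eq_smul (i : Fin m) (a : Fin m →₀ ℕ) :
    wt R p s i a = ((-1 : R) ^ (∑ k ∈ Finset.univ.filter (· < i), a k)) • coef R p (s i) (a i) := by
  rw [wt]
  rcases neg_one_pow_eq_or R (∑ k ∈ Finset.univ.filter (· < i), a k) with h | h
  all_goals
    rcases Nat.even_or_odd (∑ k ∈ Finset.univ.filter (· < i), a k) with h' | h'
    · simp [h'.neg_one_pow]
    · simp [h'.neg_one_pow]

lemma pairing_wt_anticomm {f : G → G → R} (hf : ∀ h h', f h h' = f h' h) {i j : Fin m}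
    (hij : i ≠ j) (a : Fin m →₀ ℕ) :
    pairing f (wt R p s i a) (wt R p s j (a - single i 1)) +
      pairing f (wt R p s j a) (wt R p s i (a - single j 1)) = 0 := by
  have key : ∀ i j : Fin m, i < j → pairing f (wt R p s i a) (wt R p s j (a - single i 1)) +
      pairing f (wt R p s j a) (wt R p s i (a - single j 1)) = 0 := by
    intro i j hij
    by_cases hi : a i = 0
    · rw [wt_eq_zero hi, wt_eq_zero (i := i) (a := a - single j 1)]
      · simp
      · simp [hi]
    simp only [wt_eq_smul, coef_sub_single hij.ne, coef_sub_single hij.ne', map_smul,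
      LinearMap.smul_apply, smul_eq_mul]
    rw [pairing_comm hf (coef R p (s j) (a j))]
    linear_combination pairing f (coef R p (s i) (a i)) (coef R p (s j) (a j)) *
      sign_anticomm hij hi R
  rcases lt_or_gt_of_ne hij with h | h
  · exact key i j h
  · rw [add_comm]; exact key j i h

lemma pairing_wt_self {f : G → G → R} (i : Fin m) (a : Fin m →₀ ℕ) :
    pairing f (wt R p s i a) (wt R p s i (a - single i 1)) =
      pairing f (coef R p (s i) (a i)) (coef R p (s i) (a i - 1)) := by
  simp only [wt_eq_smul, map_smul, LinearMap.smul_apply, smul_eq_mul]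
  rw [sign_same (lt_irrefl i), ← mul_assoc, ← mul_pow]
  simp

/-- The cochains for which the value of the cup product can be computed. -/
structure IsEuler (p : ℕ) (s : Fin m → G) (x : X) (o : X → X → X → R) (χ : Fin m → R) :
    Prop where
  cocycle : ∀ x y z w, o y z w - o x z w + o x y w - o x y z = 0
  invariant : ∀ (g : G) x y z, o (g +ᵥ x) (g +ᵥ y) (g +ᵥ z) = o x y z
  symm : ∀ h h' : G, transition o x h h' = transition o x h' h
  norm : ∀ i, ∑ j ∈ Finset.range p,
    (transition o x (s i) (j • s i) - transition o x 0 (j • s i)) = χ i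

lemma IsEuler.pairing_coef {x : X} {o : X → X → X → R} {χ : Fin m → R} (h : IsEuler p s x o χ)
    (i : Fin m) (n : ℕ) :
    pairing (transition o x) (coef R p (s i) (2 * n)) (coef R p (s i) (2 * n - 1)) =
      if n = 0 then 0 else χ i := by
  split_ifs with hn
  · simp [hn, coef]
  have h1 : ¬ Odd (2 * n) := by simp
  have h2 : Odd (2 * n - 1) := by rw [Nat.odd_sub (by omega)]; simp
  rw [pairing_comm h.symm]
  unfold coef
  rw [if_neg (by omega), if_pos h2, if_neg (by omega), if_neg h1, ← h.norm i, map_sum]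
  refine Finset.sum_congr rfl fun j _ ↦ ?_
  rw [AddMonoidAlgebra.single_pow, AddMonoidAlgebra.one_def, map_sub, LinearMap.sub_apply,
    pairing_single, pairing_single]
  simp

/-- The linear form with given coefficients. -/
noncomputable def linForm (χ : Fin m → R) : MvPolynomial (Fin m) R :=
  ∑ i, MvPolynomial.C (χ i) * MvPolynomial.X i

lemma coeff_linForm_mul (χ : Fin m → R) (P : MvPolynomial (Fin m) R) (a : Fin m →₀ ℕ) :
    (linForm χ * P).coeff a =
      ∑ i, if a i = 0 then 0 else χ i * P.coeff (a - single i 1) := by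
  rw [linForm, Finset.sum_mul, MvPolynomial.coeff_sum]
  refine Finset.sum_congr rfl fun i _ ↦ ?_
  rw [mul_assoc, MvPolynomial.coeff_C_mul, MvPolynomial.coeff_X_mul']
  by_cases h : a i = 0 <;> simp [h]

/-- The value of a cup product of Euler cochains on the standard family of chains. -/
lemma cupL_fam_cone {o : κ → X → X → X → R} {χ : κ → Fin m → R} {x : X}
    (ho : ∀ j, IsEuler p s x (o j) (χ j)) (L : List κ) (a : Fin m →₀ ℕ) :
    cupL o L (fam p s (fun _ ↦ cone R x) x (2 * L.length) (2 • a)) =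
      (L.map fun j ↦ linForm (χ j)).prod.coeff a := by
  have hcone : ∀ n a, ∃ c, fam p s (fun _ ↦ cone R x) x n a = cone R x c := by
    intro n a
    cases n with
    | zero =>
      by_cases h : a = 0
      · exact ⟨single [] 1, by simp [fam, h]⟩
      · exact ⟨0, by simp [fam, h]⟩
    | succ n => exact ⟨_, rfl⟩
  induction L generalizing a with
  | nil =>
    have h0 : a = 0 ↔ 0 = a := eq_comm
    by_cases h : a = 0
    · simp [fam, h]
    · simp [fam, MvPolynomial.coeff_one, h, Ne.symm h]
  | cons j L ih =>
    rw [List.map_cons, List.prod_cons, coeff_linForm_mul]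
    have h2 : 2 * (j :: L).length = 2 * L.length + 1 + 1 := by simp; ring
    rw [h2]
    set n := 2 * L.length
    have hexp : fam p s (fun _ ↦ cone R x) x (n + 1 + 1) (2 • a) =
        ∑ i, ∑ k, cone R x (act R (wt R p s i (2 • a)) (cone R x
          (act R (wt R p s k (2 • a - single i 1))
            (fam p s (fun _ ↦ cone R x) x n (2 • a - single i 1 - single k 1))))) := by
      rw [fam]
      unfold delta
      simp only [fam, delta, map_sum]
    rw [hexp]
    simp only [map_sum]
    have hterm : ∀ i k, cupL o (j :: L) (cone R x (act R (wt R p s i (2 • a)) (cone R x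
          (act R (wt R p s k (2 • a - single i 1))
            (fam p s (fun _ ↦ cone R x) x n (2 • a - single i 1 - single k 1)))))) =
        pairing (transition (o j) x) (wt R p s i (2 • a)) (wt R p s k (2 • a - single i 1)) *
          cupL o L (fam p s (fun _ ↦ cone R x) x n (2 • a - single i 1 - single k 1)) := by
      intro i k
      obtain ⟨c, hc⟩ := hcone n (2 • a - single i 1 - single k 1)
      rw [hc]
      exact cupL_cone_act o (fun j ↦ (ho j).invariant) j L x _ _ c
    simp only [hterm]
    rw [sum_sum_eq_diag]
    · refine Finset.sum_congr rfl fun i _ ↦ ?_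
      rw [pairing_wt_self]
      have : (2 • a) i = 2 * a i := by simp
      rw [this, (ho j).pairing_coef]
      by_cases hi : a i = 0
      · simp [hi]
      · rw [if_neg hi, if_neg hi, ← ih]
        congr 3
        ext k
        by_cases hk : i = k
        · subst hk
          simp
          omega
        · simp [hk]
    · intro i k hik
      have h : 2 • a - single k 1 - single i 1 = 2 • a - single i 1 - single k 1 :=
        tsub_right_comm
      rw [h, ← add_mul, pairing_wt_anticomm (ho j).symm hik, zero_mul]

/-- The value of a cup product of Euler cochains on any family of chains. -/
lemma cupL_fam {o : κ → X → X → X → R} {χ : κ → Fin m → R} {x : X}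
    (ho : ∀ j, IsEuler p s x (o j) (χ j)) (hs : ∀ i, p • s i = 0) (hp : (p : R) = 0)
    {C : ℕ → Chain R X →ₗ[R] Chain R X} (hC : ∀ n b, bd R b = 0 → bd R (C n b) = b)
    (y : X) (L : List κ) (a : Fin m →₀ ℕ) :
    cupL o L (fam p s C y (2 * L.length) (2 • a)) =
      (L.map fun j ↦ linForm (χ j)).prod.coeff a := by
  rw [← cupL_fam_cone ho]
  exact eval_fam_eq hs hp hC
    (kills_of_invariant hp (cupL_push o (fun j ↦ (ho j).invariant) L))
    (cupL_bd o (fun j ↦ (ho j).cocycle) L) y x _ _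

end Cup

section Contraction

variable (R : Type*) [CommRing R] {X Y : Type*}

/-- The contraction of chains along a discrete homotopy `φ` ending close to the point `v`. -/
noncomputable def contraction (φ : ℕ → X → X) (v : X) (M : ℕ) : Chain R X →ₗ[R] Chain R X :=
  (cone R v).comp (push R (φ M)) - ∑ j ∈ Finset.range M, prism R (φ j) (φ (j + 1))

variable {R}

lemma bd_contraction {φ : ℕ → X → X} (h0 : ∀ x, φ 0 x = x) (v : X) (M : ℕ) {b : Chain R X}
    (hb : bd R b = 0) : bd R (contraction R φ v M b) = b := by
  have hid : push R (φ 0) b = b := by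
    have : φ 0 = id := funext h0
    rw [this]
    induction b using Finsupp.induction_linear with
    | zero => simp
    | add f g hf hg =>
      have : ∀ c : Chain R X, push R id c = c := fun c ↦ by simp [push]
      exact this _
    | single l r => simp
  simp only [contraction, LinearMap.sub_apply, LinearMap.comp_apply, LinearMap.sum_apply, map_sub,
    map_sum, bd_cone, bd_prism, hb, map_zero, sub_zero]
  rw [Finset.sum_range_sub (fun j ↦ push R (φ j) b), ← push_bd, hb, hid]
  simp

lemma mem_supported_of_single {P : Set (List X)} {Q : Set (List Y)}
    (T : Chain R X →ₗ[R] Chain R Y) (hT : ∀ l ∈ P, T (single l 1) ∈ supported R R Q)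
    {c : Chain R X} (hc : c ∈ supported R R P) : T c ∈ supported R R Q := by
  have h : supported R R P ≤ (supported R R Q).comap T := by
    rw [supported_eq_span_single, Submodule.span_le]
    rintro _ ⟨l, hl, rfl⟩
    exact hT l hl
  exact h hc

lemma prismList_mem_supported (f g : X → Y) (l : List X) :
    prismList R f g l ∈ supported R R {l' | ∀ y ∈ l', ∃ x ∈ l, y = f x ∨ y = g x} := by
  induction l with
  | nil => simp [prismList]
  | cons x l ih =>
    refine Submodule.sub_mem _ ?_ ?_
    · refine single_mem_supported R _ ?_
      intro y hy
      simp only [List.mem_cons, List.mem_map] at hy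
      rcases hy with rfl | rfl | ⟨z, hz, rfl⟩
      · exact ⟨x, by simp, Or.inl rfl⟩
      · exact ⟨x, by simp, Or.inr rfl⟩
      · exact ⟨z, by simp [hz], Or.inr rfl⟩
    · refine mem_supported_of_single _ ?_ ih
      intro l' hl'
      rw [cone_single]
      refine single_mem_supported R _ ?_
      intro y hy
      rcases List.mem_cons.1 hy with rfl | hy
      · exact ⟨x, by simp, Or.inl rfl⟩
      · obtain ⟨z, hz, h⟩ := hl' y hy
        exact ⟨z, by simp [hz], h⟩

end Contraction

section Join

variable (G : Type*) [AddCommGroup G] [Fintype G]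

/-- The iterated join of `n` copies of the finite discrete space `G`. -/
def joinSet (n : ℕ) : Set (G → Fin n → ℝ) :=
  {x | (∀ g i, 0 ≤ x g i) ∧ ∑ g, ∑ i, x g i = 1 ∧ ∀ i g h, g ≠ h → x g i * x h i = 0}

variable {G} {n : ℕ}

omit [AddCommGroup G] in
lemma joinSet_le_one {x : G → Fin n → ℝ} (hx : x ∈ joinSet G n) (g : G) (i : Fin n) :
    x g i ≤ 1 := by
  rw [← hx.2.1]
  calc x g i ≤ ∑ i, x g i := Finset.single_le_sum (f := fun i ↦ x g i)
        (fun i _ ↦ hx.1 g i) (Finset.mem_univ i)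
    _ ≤ _ := Finset.single_le_sum (f := fun g ↦ ∑ i, x g i)
        (fun g _ ↦ Finset.sum_nonneg fun i _ ↦ hx.1 g i) (Finset.mem_univ g)

omit [AddCommGroup G] in
lemma isCompact_joinSet : IsCompact (joinSet G n) := by
  have hsub : joinSet G n ⊆ Set.pi Set.univ fun _ ↦ Set.pi Set.univ fun _ ↦ Set.Icc (0 : ℝ) 1 :=
    fun x hx g _ i _ ↦ ⟨hx.1 g i, joinSet_le_one hx g i⟩
  refine IsCompact.of_isClosed_subset
    (isCompact_univ_pi fun _ ↦ isCompact_univ_pi fun _ ↦ isCompact_Icc) ?_ hsub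
  have : joinSet G n = (⋂ g, ⋂ i, {x | 0 ≤ x g i}) ∩ ({x | ∑ g, ∑ i, x g i = 1} ∩
      ⋂ i, ⋂ g, ⋂ h, ⋂ _ : g ≠ h, {x | x g i * x h i = 0}) := by
    ext x
    simp [joinSet]
  rw [this]
  refine IsClosed.inter ?_ (IsClosed.inter ?_ ?_)
  · exact isClosed_iInter fun g ↦ isClosed_iInter fun i ↦
      isClosed_le continuous_const (by fun_prop)
  · exact isClosed_eq (by fun_prop) continuous_const
  · exact isClosed_iInter fun i ↦ isClosed_iInter fun g ↦ isClosed_iInter fun h ↦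
      isClosed_iInter fun _ ↦ isClosed_eq (by fun_prop) continuous_const

instance : CompactSpace (joinSet G n) := isCompact_iff_compactSpace.1 isCompact_joinSet

/-- The translation action of `G` on its iterated join. -/
instance : AddAction G (joinSet G n) where
  vadd h x := ⟨fun g ↦ x.1 (g - h), fun g i ↦ x.2.1 _ i,
    by rw [← x.2.2.1]; exact Equiv.sum_comp (Equiv.subRight h) fun g ↦ ∑ i, x.1 g i,
    fun i g g' hg ↦ x.2.2.2 i _ _ (by simpa using hg)⟩
  zero_vadd x := Subtype.ext (funext fun g ↦ congrArg x.1 (sub_zero g))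
  add_vadd g h x := Subtype.ext (funext fun k ↦ congrArg x.1 (by abel))

lemma vadd_apply (h : G) (x : joinSet G n) (g : G) : (h +ᵥ x).1 g = x.1 (g - h) := rfl

omit [AddCommGroup G] in
lemma dist_le_of_forall {x y : joinSet G n} {δ : ℝ} (hδ : 0 ≤ δ)
    (h : ∀ g i, |x.1 g i - y.1 g i| ≤ δ) : dist x y ≤ δ := by
  rw [Subtype.dist_eq, dist_pi_le_iff hδ]
  intro g
  rw [dist_pi_le_iff hδ]
  exact fun i ↦ h g i

omit [AddCommGroup G] in
lemma abs_sub_le_dist (x y : joinSet G n) (g : G) (i : Fin n) :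
    |x.1 g i - y.1 g i| ≤ dist x y :=
  ((dist_le_pi_dist (x.1 g) (y.1 g) i).trans (dist_le_pi_dist x.1 y.1 g))

lemma dist_vadd_le (h : G) (x y : joinSet G n) : dist (h +ᵥ x) (h +ᵥ y) ≤ dist x y :=
  dist_le_of_forall dist_nonneg fun g i ↦ abs_sub_le_dist x y (g - h) i

/-- The action on the join is free: there is an equivariant map to the group. -/
lemma exists_equivariant : ∃ τ : joinSet G n → G, ∀ h x, τ (h +ᵥ x) = h + τ x := by
  classical
  have hne : ∀ x : joinSet G n, ∃ i, ∃ g, x.1 g i ≠ 0 := by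
    intro x
    by_contra! hcon
    have := x.2.2.1
    simp [hcon] at this
  have hmin : ∀ x : joinSet G n, ∃ i, (∃ g, x.1 g i ≠ 0) ∧ ∀ j < i, ∀ g, x.1 g j = 0 := by
    intro x
    obtain ⟨i, hi, hi'⟩ := WellFounded.has_min (wellFounded_lt (α := Fin n))
      {i | ∃ g, x.1 g i ≠ 0} (hne x)
    refine ⟨i, hi, fun j hj g ↦ ?_⟩
    by_contra h
    exact hi' j ⟨g, h⟩ hj
  choose I hI hI' using hmin
  choose τ hτ using hI
  refine ⟨τ, fun h x ↦ ?_⟩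
  have h1 : x.1 (τ (h +ᵥ x) - h) (I (h +ᵥ x)) ≠ 0 := hτ (h +ᵥ x)
  have h2 := hτ x
  have h3 : I (h +ᵥ x) = I x := by
    refine le_antisymm (not_lt.1 fun hlt ↦ ?_) (not_lt.1 fun hlt ↦ h1 (hI' x _ hlt _))
    refine h2 ?_
    have := hI' (h +ᵥ x) _ hlt (h + τ x)
    rwa [vadd_apply, add_sub_cancel_left] at this
  rw [h3] at h1
  by_contra hcon
  have := x.2.2.2 (I x) (τ (h +ᵥ x) - h) (τ x) fun h' ↦ hcon (by rw [← h']; abel)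
  exact mul_ne_zero h1 h2 this

end Join

section Small

variable {G : Type*} [AddCommGroup G] [Fintype G] [DecidableEq G] {N : ℕ}

/-- The vertex of the join in level `i` labelled by the neutral element. -/
def vertex (N : ℕ) (i : ℕ) : joinSet G (N + 1) :=
  ⟨fun g k ↦ if g = 0 ∧ k = Fin.ofNat (N + 1) i then 1 else 0, by
    refine ⟨fun g k ↦ by positivity, ?_, fun k g h hgh ↦ ?_⟩
    · rw [Finset.sum_eq_single 0 (by intro g _ hg; simp [hg]) (by simp)]
      simp
    · by_cases hg : g = 0
      · have : h ≠ 0 := fun h' ↦ hgh (hg.trans h'.symm)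
        simp [this]
      · simp [hg]⟩

/-- The points of the join supported in the levels below `i`. -/
def Below (i : ℕ) (x : joinSet G (N + 1)) : Prop := ∀ g k, i ≤ k.1 → x.1 g k = 0

/-- The straight-line motion towards a vertex, where it is defined. -/
noncomputable def move (i : ℕ) (t : ℝ) (x : joinSet G (N + 1)) : joinSet G (N + 1) :=
  open Classical in
  if h : (fun g k ↦ (1 - t) * x.1 g k + t * (vertex (G := G) N i).1 g k) ∈ joinSet G (N + 1)
  then ⟨_, h⟩ else x

lemma move_zero (i : ℕ) (x : joinSet G (N + 1)) : move i 0 x = x := by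
  unfold move
  split_ifs
  · ext
    simp
  · rfl

lemma vertex_apply_eq_zero {i : ℕ} (hi : i ≤ N) (g : G) {k : Fin (N + 1)} (hk : k.1 ≠ i) :
    (vertex (G := G) N i).1 g k = 0 := by
  have : k ≠ Fin.ofNat (N + 1) i := by
    rintro rfl
    exact hk (by simp [Fin.ofNat, Nat.mod_eq_of_lt (Nat.lt_succ_of_le hi)])
  change (if g = 0 ∧ k = Fin.ofNat (N + 1) i then (1 : ℝ) else 0) = 0
  rw [if_neg fun h ↦ this h.2]

lemma move_apply {i : ℕ} (hi : i ≤ N) {t : ℝ} (ht0 : 0 ≤ t) (ht1 : t ≤ 1)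
    {x : joinSet G (N + 1)} (hx : Below i x) (g : G) (k : Fin (N + 1)) :
    (move i t x).1 g k = (1 - t) * x.1 g k + t * (vertex (G := G) N i).1 g k := by
  have h : (fun g k ↦ (1 - t) * x.1 g k + t * (vertex (G := G) N i).1 g k) ∈
      joinSet G (N + 1) := by
    refine ⟨fun g k ↦ ?_, ?_, fun k g h hgh ↦ ?_⟩
    · have h1 := x.2.1 g k
      have h2 := (vertex (G := G) N i).2.1 g k
      have h3 := sub_nonneg.2 ht1
      positivity
    · simp only [Finset.sum_add_distrib, ← Finset.mul_sum]
      rw [x.2.2.1, (vertex (G := G) N i).2.2.1]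
      ring
    · by_cases hk : i ≤ k.1
      · simp only [hx _ k hk, mul_zero, zero_add]
        have := (vertex (G := G) N i).2.2.2 k g h hgh
        linear_combination t ^ 2 * this
      · simp only [vertex_apply_eq_zero hi _ (k := k) (by omega), mul_zero, add_zero]
        have := x.2.2.2 k g h hgh
        linear_combination (1 - t) ^ 2 * this
  unfold move
  rw [dif_pos h]

lemma below_vertex {i : ℕ} (hi : i ≤ N) : Below (i + 1) (vertex (G := G) N i) :=
  fun g _ hk ↦ vertex_apply_eq_zero hi g (by omega)

lemma below_move {i : ℕ} (hi : i ≤ N) {t : ℝ} (ht0 : 0 ≤ t) (ht1 : t ≤ 1)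
    {x : joinSet G (N + 1)} (hx : Below i x) : Below (i + 1) (move i t x) := by
  intro g k hk
  rw [move_apply hi ht0 ht1 hx, hx g k (by omega), below_vertex hi g k hk]
  simp

omit [AddCommGroup G] [DecidableEq G] in
lemma abs_apply_sub_le (x y : joinSet G (N + 1)) (g : G) (k : Fin (N + 1)) :
    |x.1 g k - y.1 g k| ≤ 1 := by
  have h1 := x.2.1 g k
  have h2 := y.2.1 g k
  have h3 := joinSet_le_one x.2 g k
  have h4 := joinSet_le_one y.2 g k
  rw [abs_le]
  constructor <;> linarith

lemma dist_move_le {i : ℕ} (hi : i ≤ N) {t u : ℝ} (ht0 : 0 ≤ t) (ht1 : t ≤ 1) (hu0 : 0 ≤ u)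
    (hu1 : u ≤ 1) {x y : joinSet G (N + 1)} (hx : Below i x) (hy : Below i y) :
    dist (move i t x) (move i u y) ≤ dist x y + |t - u| := by
  refine dist_le_of_forall (by positivity) fun g k ↦ ?_
  rw [move_apply hi ht0 ht1 hx, move_apply hi hu0 hu1 hy]
  set v := (vertex (G := G) N i).1 g k with hv
  have h1 := abs_sub_le_dist x y g k
  have h2 : |v - y.1 g k| ≤ 1 := abs_apply_sub_le (vertex (G := G) N i) y g k
  have h3 : (1 - t) * x.1 g k + t * v - ((1 - u) * y.1 g k + u * v) =
      (1 - t) * (x.1 g k - y.1 g k) + (t - u) * (v - y.1 g k) := by ring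
  rw [h3]
  refine (abs_add_le _ _).trans ?_
  rw [abs_mul, abs_mul, abs_of_nonneg (sub_nonneg.2 ht1)]
  have h4 := abs_nonneg (x.1 g k - y.1 g k)
  have h5 := abs_nonneg (t - u)
  nlinarith

lemma dist_vertex_move_le {i : ℕ} (hi : i ≤ N) {t : ℝ} (ht0 : 0 ≤ t) (ht1 : t ≤ 1)
    {x : joinSet G (N + 1)} (hx : Below i x) : dist (vertex N i) (move i t x) ≤ 1 - t := by
  refine dist_le_of_forall (by linarith) fun g k ↦ ?_
  rw [move_apply hi ht0 ht1 hx]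
  have h2 := abs_apply_sub_le (vertex (G := G) N i) x g k
  have h3 : (vertex (G := G) N i).1 g k -
      ((1 - t) * x.1 g k + t * (vertex (G := G) N i).1 g k) =
      (1 - t) * ((vertex (G := G) N i).1 g k - x.1 g k) := by ring
  rw [h3, abs_mul, abs_of_nonneg (sub_nonneg.2 ht1)]
  nlinarith

/-- The simplices of diameter at most `δ` in the levels below `i`. -/
def Small (i : ℕ) (δ : ℝ) : Set (List (joinSet G (N + 1))) :=
  {l | (∀ x ∈ l, Below i x) ∧ ∀ x ∈ l, ∀ y ∈ l, dist x y ≤ δ}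

variable {R : Type*} [CommRing R]

/-- The subdivided cone operator of the join towards the vertex in level `i`. -/
noncomputable def joinCone (M i : ℕ) :
    Chain R (joinSet G (N + 1)) →ₗ[R] Chain R (joinSet G (N + 1)) :=
  contraction R (fun j ↦ move i ((j : ℝ) / (M + 1))) (vertex N i) M

lemma joinCone_mem_supported {M i : ℕ} (hi : i ≤ N) {δ : ℝ} (hδ : 0 ≤ δ)
    {c : Chain R (joinSet G (N + 1))} (hc : c ∈ supported R R (Small (G := G) i δ)) :
    joinCone M i c ∈ supported R R (Small (G := G) (i + 1) (δ + 1 / (M + 1))) := by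
  have hM : (0 : ℝ) < M + 1 := by positivity
  have hin : ∀ j : ℕ, j ≤ M → 0 ≤ (j : ℝ) / (M + 1) ∧ (j : ℝ) / (M + 1) ≤ 1 := by
    intro j hj
    refine ⟨by positivity, ?_⟩
    rw [div_le_one hM]
    have : (j : ℝ) ≤ M := by exact_mod_cast hj
    linarith
  refine mem_supported_of_single _ ?_ hc
  rintro l ⟨hl1, hl2⟩
  simp only [joinCone, contraction, LinearMap.sub_apply, LinearMap.comp_apply,
    LinearMap.sum_apply, push_single, cone_single, prism_single, one_smul]
  refine Submodule.sub_mem _ ?_ (Submodule.sum_mem _ fun j hj ↦ ?_)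
  · refine single_mem_supported R _ ?_
    obtain ⟨h0, h1⟩ := hin M le_rfl
    have hgap : 1 - (M : ℝ) / (M + 1) = 1 / (M + 1) := by field_simp; ring
    have hv : ∀ x ∈ l, dist (vertex N i) (move i ((M : ℝ) / (M + 1)) x) ≤ δ + 1 / (M + 1) := by
      intro x hx
      refine (dist_vertex_move_le hi h0 h1 (hl1 x hx)).trans ?_
      rw [hgap]
      linarith
    constructor
    · intro x hx
      simp only [List.mem_cons, List.mem_map] at hx
      rcases hx with rfl | ⟨y, hy, rfl⟩
      · exact below_vertex hi
      · exact below_move hi h0 h1 (hl1 y hy)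
    · intro x hx y hy
      simp only [List.mem_cons, List.mem_map] at hx hy
      rcases hx with rfl | ⟨x, hx, rfl⟩ <;> rcases hy with rfl | ⟨y, hy, rfl⟩
      · rw [dist_self]; positivity
      · exact hv y hy
      · rw [dist_comm]; exact hv x hx
      · refine (dist_move_le hi h0 h1 h0 h1 (hl1 x hx) (hl1 y hy)).trans ?_
        rw [sub_self, abs_zero, add_zero]
        have := hl2 x hx y hy
        have : 0 ≤ 1 / ((M : ℝ) + 1) := by positivity
        linarith
  · have hjM : j < M := Finset.mem_range.1 hj
    refine supported_mono ?_ (prismList_mem_supported _ _ l)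
    intro l' hl'
    have h0 := hin j hjM.le
    have h1 := hin (j + 1) hjM
    have key : ∀ y ∈ l', ∃ x ∈ l, ∃ t, (t = (j : ℝ) / (M + 1) ∨ t = ((j + 1 : ℕ) : ℝ) / (M + 1)) ∧
        (0 ≤ t ∧ t ≤ 1) ∧ y = move i t x := by
      intro y hy
      obtain ⟨x, hx, h | h⟩ := hl' y hy
      · exact ⟨x, hx, _, Or.inl rfl, h0, h⟩
      · exact ⟨x, hx, _, Or.inr rfl, h1, h⟩
    constructor
    · intro y hy
      obtain ⟨x, hx, t, -, ht, rfl⟩ := key y hy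
      exact below_move hi ht.1 ht.2 (hl1 x hx)
    · intro y hy y' hy'
      obtain ⟨x, hx, t, ht, ht', rfl⟩ := key y hy
      obtain ⟨x', hx', u, hu, hu', rfl⟩ := key y' hy'
      refine (dist_move_le hi ht'.1 ht'.2 hu'.1 hu'.2 (hl1 x hx) (hl1 x' hx')).trans ?_
      have h3 : ((j + 1 : ℕ) : ℝ) / (M + 1) - (j : ℝ) / (M + 1) = 1 / (M + 1) := by
        push_cast
        field_simp
        ring
      have h4 : |t - u| ≤ 1 / ((M : ℝ) + 1) := by
        have h5 : 0 ≤ 1 / ((M : ℝ) + 1) := by positivity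
        rcases ht with rfl | rfl <;> rcases hu with rfl | rfl
        · simpa using h5
        · rw [abs_sub_comm, h3, abs_of_nonneg h5]
        · rw [h3, abs_of_nonneg h5]
        · simpa using h5
      have := hl2 x hx x' hx'
      linarith

omit [DecidableEq G] in
lemma act_mem_supported {i : ℕ} {δ : ℝ} (D : AddMonoidAlgebra R G)
    {c : Chain R (joinSet G (N + 1))} (hc : c ∈ supported R R (Small (G := G) i δ)) :
    act R D c ∈ supported R R (Small (G := G) i δ) := by
  induction D using AddMonoidAlgebra.induction_linear with
  | zero => simp
  | add D E hD hE =>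
    rw [map_add, LinearMap.add_apply]
    exact Submodule.add_mem _ hD hE
  | single g r =>
    rw [act_single]
    refine Submodule.smul_mem _ _ (mem_supported_of_single _ ?_ hc)
    rintro l ⟨hl1, hl2⟩
    rw [push_single]
    refine single_mem_supported R _ ⟨?_, ?_⟩
    · intro x hx
      obtain ⟨x', hx', rfl⟩ := List.mem_map.1 hx
      exact fun h k hk ↦ hl1 x' hx' _ k hk
    · intro x hx y hy
      obtain ⟨x', hx', rfl⟩ := List.mem_map.1 hx
      obtain ⟨y', hy', rfl⟩ := List.mem_map.1 hy
      exact (dist_vadd_le g x' y').trans (hl2 x' hx' y' hy')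

lemma fam_mem_supported {m p : ℕ} (s : Fin m → G) (M : ℕ) (n : ℕ) (hn : n ≤ N)
    (a : Fin m →₀ ℕ) :
    fam p s (fun i ↦ joinCone (R := R) M (i + 1)) (vertex N 0) n a ∈
      supported R R (Small (G := G) (N := N) (n + 1) (n / (M + 1))) := by
  induction n generalizing a with
  | zero =>
    unfold fam
    split_ifs
    · refine single_mem_supported R _ ⟨?_, ?_⟩
      · intro x hx
        rw [List.mem_singleton.1 hx]
        exact below_vertex (Nat.zero_le _)
      · intro x hx y hy
        rw [List.mem_singleton.1 hx, List.mem_singleton.1 hy]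
        simp
    · exact Submodule.zero_mem _
  | succ n ih =>
    have h1 : delta p s (fam p s (fun i ↦ joinCone (R := R) M (i + 1)) (vertex N 0) n) a ∈
        supported R R (Small (G := G) (N := N) (n + 1) (n / (M + 1))) :=
      Submodule.sum_mem _ fun i _ ↦ act_mem_supported _ (ih (by omega) _)
    have h2 := joinCone_mem_supported (M := M) hn (by positivity) h1
    have h3 : ((n + 1 : ℕ) : ℝ) / (M + 1) = n / (M + 1) + 1 / (M + 1) := by
      push_cast; ring
    rw [h3]
    exact h2

end Small

section Euler

variable {X : Type*}

/-- The sum of the angles along a triangle, in full turns. -/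
noncomputable def winding (u : X → ℂ) (x y z : X) : ℤ :=
  round (((u y / u x).arg + (u z / u y).arg - (u z / u x).arg) / (2 * Real.pi))

lemma winding_eq_iff (u : X → ℂ) (hu : ∀ x, u x ≠ 0) (x y z : X) :
    2 * Real.pi * winding u x y z = (u y / u x).arg + (u z / u y).arg - (u z / u x).arg := by
  have hpi := Real.two_pi_pos
  have h : (((u y / u x).arg + (u z / u y).arg - (u z / u x).arg : ℝ) : Real.Angle) = 0 := by
    rw [Real.Angle.coe_sub, Real.Angle.coe_add,
      ← Complex.arg_mul_coe_angle (div_ne_zero (hu _) (hu _)) (div_ne_zero (hu _) (hu _)),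
      sub_eq_zero]
    congr 2
    have h1 := hu x
    have h2 := hu y
    field_simp
  obtain ⟨n, hn⟩ := Real.Angle.coe_eq_zero_iff.1 h
  rw [winding, ← hn, zsmul_eq_mul, mul_div_cancel_right₀ _ hpi.ne', round_intCast, mul_comm]

lemma winding_eq_zero (u : X → ℂ) (hu : ∀ x, u x ≠ 0) {x y z : X}
    (h1 : 0 < (u y / u x).re) (h2 : 0 < (u z / u y).re) (h3 : 0 < (u z / u x).re) :
    winding u x y z = 0 := by
  have h := winding_eq_iff u hu x y z
  have hpi := Real.two_pi_pos
  have a1 := abs_lt.1 (Complex.abs_arg_lt_pi_div_two_iff.2 (Or.inl h1))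
  have a2 := abs_lt.1 (Complex.abs_arg_lt_pi_div_two_iff.2 (Or.inl h2))
  have a3 := abs_lt.1 (Complex.abs_arg_lt_pi_div_two_iff.2 (Or.inl h3))
  have b1 : (winding u x y z : ℝ) < 1 := by nlinarith
  have b2 : (-1 : ℝ) < winding u x y z := by nlinarith
  have c1 : winding u x y z < 1 := by exact_mod_cast b1
  have c2 : -1 < winding u x y z := by exact_mod_cast b2
  omega

variable {G : Type*} [AddCommGroup G] [AddAction G X] {p : ℕ} [NeZero p]

lemma isEuler_winding {m : ℕ} {s : Fin m → G} (hs : ∀ i, p • s i = 0) (cls : G →+ ZMod p)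
    {u : X → ℂ} (hu : ∀ x, u x ≠ 0)
    (he : ∀ h x, u (h +ᵥ x) = ZMod.stdAddChar (cls h) * u x) (x : X) :
    IsEuler p s x (fun x y z ↦ (winding u x y z : ZMod p)) (fun i ↦ cls (s i)) := by
  have hpi := Real.two_pi_pos
  have hW := winding_eq_iff u hu
  have hratio (h : G) (y z : X) : u (h +ᵥ y) / u (h +ᵥ z) = u y / u z := by
    rw [he, he, mul_div_mul_left]
    exact fun h0 ↦ hu (h +ᵥ y) (by rw [he, h0, zero_mul])
  have htr (h h' : G) : (u ((h + h') +ᵥ x) / u (h +ᵥ x)) = ZMod.stdAddChar (cls h') := by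
    rw [add_vadd, hratio, he, mul_div_cancel_right₀ _ (hu x)]
  have htr0 (h : G) : u (h +ᵥ x) / u x = ZMod.stdAddChar (cls h) := by
    rw [he, mul_div_cancel_right₀ _ (hu x)]
  have hT (h h' : G) : 2 * Real.pi * winding u x (h +ᵥ x) ((h + h') +ᵥ x) =
      (ZMod.stdAddChar (cls h)).arg + (ZMod.stdAddChar (cls h')).arg -
        (ZMod.stdAddChar (cls (h + h'))).arg := by
    rw [hW, htr, htr0, htr0]
  refine ⟨fun x y z w ↦ ?_, fun g x y z ↦ ?_, fun h h' ↦ ?_, fun i ↦ ?_⟩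
  · have : winding u y z w - winding u x z w + winding u x y w - winding u x y z = 0 := by
      have : (2 * Real.pi) * ((winding u y z w : ℝ) - winding u x z w + winding u x y w -
          winding u x y z) = 0 := by
        linear_combination hW y z w - hW x z w + hW x y w - hW x y z
      exact_mod_cast (mul_eq_zero.1 this).resolve_left hpi.ne'
    exact_mod_cast congrArg (Int.cast : ℤ → ZMod p) this
  · simp only [winding, hratio]
  · have : (2 * Real.pi) * (winding u x (h +ᵥ x) ((h + h') +ᵥ x) : ℝ) =
        (2 * Real.pi) * (winding u x (h' +ᵥ x) ((h' + h) +ᵥ x) : ℝ) := by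
      rw [hT, hT, add_comm h' h]
      ring
    have : winding u x (h +ᵥ x) ((h + h') +ᵥ x) = winding u x (h' +ᵥ x) ((h' + h) +ᵥ x) := by
      exact_mod_cast mul_left_cancel₀ hpi.ne' this
    simp only [transition, this]
  · have h0 (h' : G) : winding u x ((0 : G) +ᵥ x) ((0 + h') +ᵥ x) = 0 := by
      have := hT 0 h'
      rw [map_zero, AddChar.map_zero_eq_one, Complex.arg_one, zero_add, zero_add, sub_self] at this
      have h2 := (mul_eq_zero.1 this).resolve_left hpi.ne'
      rw [zero_add]
      exact_mod_cast h2
    simp only [transition, h0, Int.cast_zero, sub_zero]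
    rw [← Int.cast_sum]
    obtain ⟨n, hn⟩ : ∃ n : ℤ, (ZMod.stdAddChar (cls (s i))).arg =
        2 * Real.pi * ((cls (s i)).val / p + n) := by
      have h1 : ZMod.stdAddChar (cls (s i)) =
          Complex.exp ((2 * Real.pi * ((cls (s i)).val / p) : ℝ) * Complex.I) := by
        have := ZMod.stdAddChar_coe (N := p) ((cls (s i)).val : ℤ)
        rw [Int.cast_natCast, ZMod.natCast_zmod_val] at this
        rw [this]
        congr 1
        push_cast
        ring
      rw [h1, Complex.arg_exp_mul_I, toIocMod, zsmul_eq_mul]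
      refine ⟨-toIocDiv Real.two_pi_pos (-Real.pi) (2 * Real.pi * ((cls (s i)).val / p)), ?_⟩
      push_cast
      ring
    have hsum (q : ℕ) : 2 * Real.pi * ((∑ j ∈ Finset.range q,
        winding u x (s i +ᵥ x) ((s i + j • s i) +ᵥ x) : ℤ) : ℝ) =
        q * (ZMod.stdAddChar (cls (s i))).arg - (ZMod.stdAddChar (cls (q • s i))).arg := by
      induction q with
      | zero => simp
      | succ q ih =>
        rw [Finset.sum_range_succ, Int.cast_add, mul_add, ih, hT, succ_nsmul' (s i) q]
        push_cast
        ring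
    have h3 := hsum p
    rw [hs i, map_zero, AddChar.map_zero_eq_one, Complex.arg_one, hn] at h3
    have hp : (p : ℝ) ≠ 0 := Nat.cast_ne_zero.2 (NeZero.ne p)
    have h4 : (∑ j ∈ Finset.range p, winding u x (s i +ᵥ x) ((s i + j • s i) +ᵥ x)) =
        ((cls (s i)).val : ℤ) + p * n := by
      have : 2 * Real.pi * ((∑ j ∈ Finset.range p,
          winding u x (s i +ᵥ x) ((s i + j • s i) +ᵥ x) : ℤ) : ℝ) =
          2 * Real.pi * ((((cls (s i)).val : ℤ) + p * n : ℤ) : ℝ) := by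
        rw [h3]
        push_cast
        field_simp
        ring
      exact_mod_cast mul_left_cancel₀ hpi.ne' this
    rw [h4]
    simp

end Euler

section CommonZero

lemma re_div_pos {a b : ℂ} (h : ‖a - b‖ < ‖b‖) : 0 < (a / b).re := by
  have hb : b ≠ 0 := by
    rintro rfl
    simp at h
    exact absurd h (norm_nonneg _).not_gt
  have h1 : ‖1 - a / b‖ < 1 := by
    rw [one_sub_div hb, norm_div, norm_sub_rev, div_lt_one (norm_pos_iff.2 hb)]
    exact h
  have h2 := (Complex.re_le_norm _).trans_lt h1
  rw [Complex.sub_re, Complex.one_re] at h2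
  linarith

lemma linForm_ne_zero {R : Type*} [CommRing R] {m : ℕ} {χ : Fin m → R} (h : χ ≠ 0) :
    linForm χ ≠ 0 := by
  obtain ⟨i, hi⟩ := Function.ne_iff.1 h
  intro h0
  have := congrArg (MvPolynomial.coeff (Finsupp.single i 1)) h0
  rw [linForm, MvPolynomial.coeff_sum, Finset.sum_eq_single i] at this
  · simp at this
    exact hi this
  · intro j _ hj
    rw [MvPolynomial.coeff_C_mul, MvPolynomial.coeff_X, if_neg, mul_zero]
    rw [Finsupp.single_left_inj one_ne_zero]
    exact hj
  · simp

lemma cupL_eq_zero_of_mem_supported {R X κ : Type*} [CommRing R] (o : κ → X → X → X → R)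
    (L : List κ) {P : Set (List X)} (hP : ∀ l ∈ P, cup o L l = 0) {c : Chain R X}
    (hc : c ∈ supported R R P) : cupL o L c = 0 := by
  rw [← c.sum_single, map_finsuppSum]
  refine Finset.sum_eq_zero fun l hl ↦ ?_
  dsimp only
  rw [cupL_single, hP l ((mem_supported R c).1 hc hl)]
  simp

theorem exists_common_zero {p m N : ℕ} [Fact p.Prime] {κ : Type*} [Fintype κ]
    (hN : N = 2 * Fintype.card κ) {χ : κ → Fin m → ZMod p} (hχ : ∀ j, χ j ≠ 0)
    {F : κ → joinSet (Fin m → ZMod p) (N + 1) → ℂ} (hF : ∀ j, Continuous (F j))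
    (he : ∀ j h x, F j (h +ᵥ x) = ZMod.stdAddChar (χ j ⬝ᵥ h) * F j x) :
    ∃ x, ∀ j, F j x = 0 := by
  classical
  by_contra! hne
  let G := Fin m → ZMod p
  let X := joinSet G (N + 1)
  have : Nonempty X := ⟨vertex N 0⟩
  obtain ⟨τ, hτ⟩ := exists_equivariant (G := G) (n := N + 1)
  have hchar (a : ZMod p) : ZMod.stdAddChar a ≠ 0 := (AddChar.val_isUnit _ a).ne_zero
  let u (j : κ) (x : X) : ℂ := if F j x = 0 then ZMod.stdAddChar (χ j ⬝ᵥ τ x) else F j x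
  have hu (j : κ) (x : X) : u j x ≠ 0 := by
    dsimp only [u]
    split_ifs with h
    exacts [hchar _, h]
  let cls (j : κ) : G →+ ZMod p := AddMonoidHom.mk' (fun h ↦ χ j ⬝ᵥ h) (dotProduct_add _)
  have hue (j : κ) (h : G) (x : X) : u j (h +ᵥ x) = ZMod.stdAddChar (cls j h) * u j x := by
    have h1 : F j (h +ᵥ x) = 0 ↔ F j x = 0 := by
      rw [he, mul_eq_zero, or_iff_right (hchar _)]
    dsimp only [u, cls, AddMonoidHom.mk'_apply]
    simp only [h1]
    split_ifs
    · rw [hτ, dotProduct_add, AddChar.map_add_eq_mul]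
      rfl
    · exact he j h x
  let s (i : Fin m) : G := Pi.single i 1
  have hs (i : Fin m) : p • s i = 0 := by
    ext k
    rw [Pi.smul_apply, nsmul_eq_mul, CharP.cast_eq_zero, zero_mul, Pi.zero_apply]
  let o (j : κ) (x y z : X) : ZMod p := (winding (u j) x y z : ZMod p)
  have ho (j : κ) : IsEuler p s (vertex N 0) (o j) (χ j) := by
    have h1 : (fun i ↦ cls j (s i)) = χ j := by
      ext i
      simp [cls, s]
    have := isEuler_winding (p := p) hs (cls j) (hu j) (hue j) (vertex N 0)
    rwa [h1] at this
  let Φ (x : X) (j : κ) : ℂ := F j x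
  have hΦ : Continuous Φ := continuous_pi hF
  obtain ⟨x₀, -, hx₀⟩ := isCompact_univ.exists_isMinOn (Set.univ_nonempty (α := X))
    hΦ.norm.continuousOn
  set ε := ‖Φ x₀‖ with hε_def
  have hε : 0 < ε := norm_pos_iff.2 fun h0 ↦ by
    obtain ⟨j, hj⟩ := hne x₀
    exact hj (congrFun h0 j)
  have hlarge (x : X) : ∃ j, ε ≤ ‖F j x‖ := by
    by_contra! h
    exact ((pi_norm_lt_iff hε).2 h).not_ge (hx₀ (Set.mem_univ x))
  obtain ⟨δ, hδ, hΦδ⟩ := Metric.uniformContinuous_iff.1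
    (CompactSpace.uniformContinuous_of_continuous hΦ) (ε / 4) (by positivity)
  have hclose (j : κ) {x y : X} (hxy : dist x y ≤ δ / 2) : ‖F j x - F j y‖ < ε / 4 := by
    rw [← dist_eq_norm]
    exact (dist_le_pi_dist (Φ x) (Φ y) j).trans_lt (hΦδ (by linarith))
  have hcup (i : ℕ) : ∀ l ∈ Small (G := G) (N := N) i (δ / 2),
      cup o Finset.univ.toList l = 0 := by
    rintro l ⟨-, hl⟩
    obtain ⟨x, hx⟩ : ∃ x : X, x ∈ l ∨ l = [] := by
      rcases l with - | ⟨x, l⟩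
      · exact ⟨vertex N 0, Or.inr rfl⟩
      · exact ⟨x, Or.inl (by simp)⟩
    obtain ⟨j, hj⟩ := hlarge x
    have hx' : ∀ y ∈ l, x ∈ l := by
      rintro y hy
      rcases hx with hx | rfl
      exacts [hx, absurd hy (by simp)]
    have hbig : ∀ y ∈ l, ε / 2 < ‖F j y‖ := by
      intro y hy
      have h1 := hclose j (hl x (hx' y hy) y hy)
      have h2 := norm_sub_norm_le (F j x) (F j y)
      linarith
    have hu' : ∀ y ∈ l, u j y = F j y := fun y hy ↦ if_neg fun h0 ↦ by
      have := hbig y hy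
      rw [h0, norm_zero] at this
      linarith
    have hre : ∀ y ∈ l, ∀ z ∈ l, 0 < (u j z / u j y).re := by
      intro y hy z hz
      rw [hu' y hy, hu' z hz]
      refine re_div_pos ?_
      have h1 := hclose j (hl z hz y hy)
      have h2 := hbig y hy
      linarith
    refine cup_eq_zero_of_mem o (j := j) (by simp) fun y hy z hz w hw ↦ ?_
    dsimp only [o]
    rw [winding_eq_zero _ (hu j) (hre y hy z hz) (hre z hz w hw) (hre y hy w hw), Int.cast_zero]
  obtain ⟨M, hM⟩ := exists_nat_gt (N / (δ / 2))
  have hM' : (N : ℝ) / (M + 1) ≤ δ / 2 := by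
    rw [div_lt_iff₀ (by positivity)] at hM
    rw [div_le_iff₀ (by positivity)]
    nlinarith
  have hprod : ((Finset.univ : Finset κ).toList.map fun j ↦ linForm (χ j)).prod ≠ 0 := by
    refine List.prod_ne_zero fun h0 ↦ ?_
    obtain ⟨j, -, hj⟩ := List.mem_map.1 h0
    exact linForm_ne_zero (hχ j) hj
  obtain ⟨a, ha⟩ := MvPolynomial.ne_zero_iff.1 hprod
  refine ha ?_
  rw [← cupL_fam ho hs (CharP.cast_eq_zero _ p) (C := fun i ↦ joinCone M (i + 1))
    (fun n b hb ↦ bd_contraction (fun x ↦ ?_) _ _ hb) (vertex N 0)]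
  · refine cupL_eq_zero_of_mem_supported o _ (P := Small (N + 1) (δ / 2)) (hcup _) ?_
    have hlen : 2 * (Finset.univ : Finset κ).toList.length = N := by
      rw [Finset.length_toList, hN, Finset.card_univ]
    rw [hlen]
    refine supported_mono ?_ (fam_mem_supported s M N le_rfl _)
    exact fun l hl ↦ ⟨hl.1, fun x hx y hy ↦ (hl.2 x hx y hy).trans hM'⟩
  · rw [Nat.cast_zero, zero_div, move_zero]

end CommonZero

section Fourier

variable {p m : ℕ} [Fact p.Prime]

/-- The Fourier coefficient of a function on an elementary abelian group. -/
noncomputable def fourierCoef (v : Fin m → ZMod p) (φ : (Fin m → ZMod p) → ℂ) : ℂ :=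
  ∑ g, ZMod.stdAddChar (v ⬝ᵥ g) * φ g

lemma sum_stdAddChar_dotProduct (a : Fin m → ZMod p) (ha : a ≠ 0) :
    ∑ v : Fin m → ZMod p, ZMod.stdAddChar (v ⬝ᵥ a) = 0 := by
  obtain ⟨i, hi⟩ := Function.ne_iff.1 ha
  let ψ : AddChar (Fin m → ZMod p) ℂ := (ZMod.stdAddChar (N := p)).compAddMonoidHom
    (AddMonoidHom.mk' (fun v ↦ v ⬝ᵥ a) fun v w ↦ add_dotProduct v w a)
  refine AddChar.sum_eq_zero_of_ne_one (ψ := ψ) fun h ↦ hi ?_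
  have h1 : ψ (Pi.single i 1) = 1 := by rw [h]; rfl
  have h2 : ZMod.stdAddChar (a i) = ZMod.stdAddChar (0 : ZMod p) := by
    rw [AddChar.map_zero_eq_one, ← h1]
    change _ = ZMod.stdAddChar (Pi.single i 1 ⬝ᵥ a)
    simp
  exact ZMod.injective_stdAddChar h2

lemma eq_of_fourierCoef_eq_zero {φ : (Fin m → ZMod p) → ℂ}
    (h : ∀ v, v ≠ 0 → fourierCoef v φ = 0) (g g' : Fin m → ZMod p) : φ g = φ g' := by
  have key (x : Fin m → ZMod p) :
      fourierCoef 0 φ = Fintype.card (Fin m → ZMod p) * φ x := by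
    have h1 : ∑ v, ZMod.stdAddChar (-(v ⬝ᵥ x)) * fourierCoef v φ = fourierCoef 0 φ := by
      rw [Finset.sum_eq_single 0]
      · simp
      · intro v _ hv
        rw [h v hv, mul_zero]
      · simp
    rw [← h1]
    unfold fourierCoef
    simp_rw [Finset.mul_sum]
    rw [Finset.sum_comm, Finset.sum_eq_single x]
    · simp_rw [← mul_assoc, ← AddChar.map_add_eq_mul, neg_add_cancel, AddChar.map_zero_eq_one]
      simp
    · intro y _ hy
      simp_rw [← mul_assoc, ← AddChar.map_add_eq_mul, neg_add_eq_sub, ← dotProduct_sub]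
      rw [← Finset.sum_mul, sum_stdAddChar_dotProduct _ (sub_ne_zero.2 hy), zero_mul]
    · simp
  have hc : (Fintype.card (Fin m → ZMod p) : ℂ) ≠ 0 := Nat.cast_ne_zero.2 Fintype.card_ne_zero
  exact mul_left_cancel₀ hc ((key g).symm.trans (key g'))

lemma fourierCoef_translate (v h : Fin m → ZMod p) (φ : (Fin m → ZMod p) → ℂ) :
    fourierCoef v (fun g ↦ φ (g - h)) = ZMod.stdAddChar (v ⬝ᵥ h) * fourierCoef v φ := by
  unfold fourierCoef
  rw [Finset.mul_sum, ← Equiv.sum_comp (Equiv.addRight h)]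
  refine Finset.sum_congr rfl fun g _ ↦ ?_
  simp only [Equiv.coe_addRight, add_sub_cancel_right, dotProduct_add, AddChar.map_add_eq_mul]
  ring

lemma conj_fourierCoef (v : Fin m → ZMod p) (φ : (Fin m → ZMod p) → ℂ) :
    (starRingEnd ℂ) (fourierCoef v φ) = fourierCoef (-v) fun g ↦ (starRingEnd ℂ) (φ g) := by
  unfold fourierCoef
  rw [map_sum]
  refine Finset.sum_congr rfl fun g _ ↦ ?_
  rw [map_mul, ← AddChar.map_neg_eq_conj, neg_dotProduct]

lemma continuous_fourierCoef {X : Type*} [TopologicalSpace X] (v : Fin m → ZMod p)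
    {φ : X → (Fin m → ZMod p) → ℂ} (hφ : ∀ g, Continuous fun x ↦ φ x g) :
    Continuous fun x ↦ fourierCoef v (φ x) :=
  continuous_finsetSum _ fun g _ ↦ continuous_const.mul (hφ g)

/-- A choice of one element from each pair of distinct opposite elements. -/
noncomputable def positiveHalf (p m : ℕ) [Fact p.Prime] : Finset (Fin m → ZMod p) :=
  {v | Fintype.equivFin (Fin m → ZMod p) v < Fintype.equivFin (Fin m → ZMod p) (-v)}

lemma ne_zero_of_mem_positiveHalf {v : Fin m → ZMod p} (hv : v ∈ positiveHalf p m) : v ≠ 0 := by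
  rintro rfl
  simp [positiveHalf] at hv

lemma mem_or_neg_mem_positiveHalf (hp : p ≠ 2) {v : Fin m → ZMod p} (hv : v ≠ 0) :
    v ∈ positiveHalf p m ∨ -v ∈ positiveHalf p m := by
  simp only [positiveHalf, Finset.mem_filter, Finset.mem_univ, true_and, neg_neg]
  refine lt_or_gt_of_ne fun h ↦ hv ?_
  have h1 : v = -v := (Fintype.equivFin (Fin m → ZMod p)).injective h
  ext i
  by_contra h2
  exact ZMod.ne_neg_self ((Fact.out : p.Prime).odd_of_ne_two hp) h2 (congrFun h1 i)

lemma two_mul_card_positiveHalf (hp : p ≠ 2) :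
    2 * (positiveHalf p m).card = p ^ m - 1 := by
  classical
  have h1 : positiveHalf p m ∪ (positiveHalf p m).map (Equiv.neg _).toEmbedding =
      Finset.univ.erase 0 := by
    ext v
    simp only [Finset.mem_union, Finset.mem_map_equiv, Equiv.neg_symm, Equiv.neg_apply,
      Finset.mem_erase, Finset.mem_univ, and_true]
    refine ⟨?_, mem_or_neg_mem_positiveHalf hp⟩
    rintro (h | h)
    · exact ne_zero_of_mem_positiveHalf h
    · exact neg_ne_zero.1 (ne_zero_of_mem_positiveHalf h)
  have h2 : Disjoint (positiveHalf p m) ((positiveHalf p m).map (Equiv.neg _).toEmbedding) := by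
    rw [Finset.disjoint_left]
    intro v hv hv'
    simp only [Finset.mem_map_equiv, Equiv.neg_symm, Equiv.neg_apply, positiveHalf,
      Finset.mem_filter, Finset.mem_univ, true_and, neg_neg] at hv hv'
    exact hv.not_gt hv'
  have h3 := congrArg Finset.card h1
  rw [Finset.card_union_of_disjoint h2, Finset.card_map, Finset.card_erase_of_mem (by simp),
    Finset.card_univ, Fintype.card_fun, ZMod.card, Fintype.card_fin] at h3
  omega

theorem exists_constant {d N : ℕ} (hN : N = d * (p ^ m - 1)) (hd : p = 2 → Even d)
    {Ψ : joinSet (Fin m → ZMod p) (N + 1) → (Fin m → ZMod p) → Fin d → ℝ}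
    (hΨ : ∀ g, Continuous fun x ↦ Ψ x g) (he : ∀ h x g, Ψ (h +ᵥ x) g = Ψ x (g - h)) :
    ∃ x, ∀ g g', Ψ x g = Ψ x g' := by
  classical
  suffices H : ∃ x, ∀ v ≠ 0, ∀ l, fourierCoef v (fun g ↦ (Ψ x g l : ℂ)) = 0 by
    obtain ⟨x, hx⟩ := H
    refine ⟨x, fun g g' ↦ funext fun l ↦ ?_⟩
    exact_mod_cast eq_of_fourierCoef_eq_zero (fun v hv ↦ hx v hv l) g g'
  by_cases hp : p = 2
  · obtain ⟨c, rfl⟩ := hd hp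
    have hconj (v : Fin m → ZMod p) : -v = v := by
      subst hp
      funext i
      exact ZMod.neg_eq_self_mod_two (v i)
    let κ := {v : Fin m → ZMod p // v ≠ 0} × Fin c
    have hκ : N = 2 * Fintype.card κ := by
      have : Fintype.card {v : Fin m → ZMod p // v ≠ 0} = p ^ m - 1 := by
        rw [Fintype.card_subtype_compl, Fintype.card_subtype_eq, Fintype.card_fun, ZMod.card,
          Fintype.card_fin]
      rw [Fintype.card_prod, this, Fintype.card_fin, hN]
      ring
    obtain ⟨x, hx⟩ := exists_common_zero hκ (χ := fun j ↦ j.1.1) (fun j ↦ j.1.2)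
      (F := fun j x ↦ fourierCoef j.1.1 fun g ↦ (Ψ x g (Fin.castAdd c j.2) : ℂ) +
        Ψ x g (Fin.natAdd c j.2) * Complex.I)
      (fun j ↦ continuous_fourierCoef _ fun g ↦ by
        have h1 := fun l ↦ Complex.continuous_ofReal.comp ((continuous_apply l).comp (hΨ g))
        exact (h1 _).add ((h1 _).mul continuous_const))
      (fun j h x ↦ by
        simp only [he]
        exact fourierCoef_translate j.1.1 h fun g ↦ (Ψ x g (Fin.castAdd c j.2) : ℂ) +
          Ψ x g (Fin.natAdd c j.2) * Complex.I)
    refine ⟨x, fun v hv ↦ ?_⟩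
    have key (l : Fin c) : fourierCoef v (fun g ↦ (Ψ x g (Fin.castAdd c l) : ℂ)) = 0 ∧
        fourierCoef v (fun g ↦ (Ψ x g (Fin.natAdd c l) : ℂ)) = 0 := by
      have h1 := hx (⟨v, hv⟩, l)
      have h2 := congrArg (starRingEnd ℂ) h1
      rw [conj_fourierCoef, hconj] at h2
      have h3 : fourierCoef v (fun g ↦ (Ψ x g (Fin.castAdd c l) : ℂ)) +
          fourierCoef v (fun g ↦ (Ψ x g (Fin.natAdd c l) : ℂ)) * Complex.I = 0 := by
        rw [← h1]
        simp only [fourierCoef, Finset.sum_mul, ← Finset.sum_add_distrib]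
        exact Finset.sum_congr rfl fun g _ ↦ by ring
      have h4 : fourierCoef v (fun g ↦ (Ψ x g (Fin.castAdd c l) : ℂ)) -
          fourierCoef v (fun g ↦ (Ψ x g (Fin.natAdd c l) : ℂ)) * Complex.I = 0 := by
        rw [map_zero] at h2
        rw [← h2]
        simp only [fourierCoef, Finset.sum_mul, ← Finset.sum_sub_distrib]
        refine Finset.sum_congr rfl fun g _ ↦ ?_
        simp only [map_add, map_mul, Complex.conj_ofReal, Complex.conj_I]
        ring
      refine ⟨by linear_combination (h3 + h4) / 2, ?_⟩
      have h5 := mul_eq_zero.1 (show fourierCoef v (fun g ↦ (Ψ x g (Fin.natAdd c l) : ℂ)) *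
        Complex.I = 0 by linear_combination (h3 - h4) / 2)
      exact h5.resolve_right Complex.I_ne_zero
    exact fun l ↦ Fin.addCases (fun l ↦ (key l).1) (fun l ↦ (key l).2) l
  · let κ := {v // v ∈ positiveHalf p m} × Fin d
    have hκ : N = 2 * Fintype.card κ := by
      rw [Fintype.card_prod, Fintype.card_coe, Fintype.card_fin, hN, ← mul_assoc,
        two_mul_card_positiveHalf hp, mul_comm]
    obtain ⟨x, hx⟩ := exists_common_zero hκ (χ := fun j ↦ j.1.1)
      (fun j ↦ ne_zero_of_mem_positiveHalf j.1.2)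
      (F := fun j x ↦ fourierCoef j.1.1 fun g ↦ (Ψ x g j.2 : ℂ))
      (fun j ↦ continuous_fourierCoef _ fun g ↦
        Complex.continuous_ofReal.comp ((continuous_apply j.2).comp (hΨ g)))
      (fun j h x ↦ by
        simp only [he]
        exact fourierCoef_translate j.1.1 h fun g ↦ (Ψ x g j.2 : ℂ))
    refine ⟨x, fun v hv l ↦ ?_⟩
    rcases mem_or_neg_mem_positiveHalf hp hv with h | h
    · exact hx (⟨v, h⟩, l)
    · have h1 := congrArg (starRingEnd ℂ) (hx (⟨-v, h⟩, l))
      rw [conj_fourierCoef, neg_neg, map_zero] at h1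
      simpa only [Complex.conj_ofReal] using h1

end Fourier

section TestMap

variable {n : ℕ}

/-- The normalization of a nonzero vector with nonnegative coordinates. -/
noncomputable def normalize (w : Fin n → ℝ) : Fin n → ℝ := fun i ↦ w i / ∑ j, w j

/-- The homogeneous extension to the orthant of a function on the standard simplex. -/
noncomputable def homogenize (φ : (Fin n → ℝ) → ℝ) (w : Fin n → ℝ) : ℝ :=
  (∑ j, w j) * φ (normalize w)

lemma normalize_mem_stdSimplex {w : Fin n → ℝ} (hw : ∀ i, 0 ≤ w i) (h : ∑ j, w j ≠ 0) :
    normalize w ∈ stdSimplex ℝ (Fin n) := by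
  refine ⟨fun i ↦ div_nonneg (hw i) (Finset.sum_nonneg fun j _ ↦ hw j), ?_⟩
  simp only [normalize]
  rw [← Finset.sum_div, div_self h]

lemma continuousOn_homogenize {φ : (Fin n → ℝ) → ℝ} (hφ : ContinuousOn φ (stdSimplex ℝ (Fin n))) :
    ContinuousOn (homogenize φ) {w | ∀ i, 0 ≤ w i} := by
  have hmass : Continuous fun w : Fin n → ℝ ↦ ∑ j, w j :=
    continuous_finsetSum _ fun j _ ↦ continuous_apply j
  intro w hw
  by_cases h : ∑ j, w j = 0
  · obtain ⟨C, hC⟩ := (isCompact_stdSimplex ℝ (Fin n)).exists_bound_of_continuousOn hφ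
    have h0 : homogenize φ w = 0 := by rw [homogenize, h, zero_mul]
    rw [ContinuousWithinAt, h0]
    have hlim : Filter.Tendsto (fun w : Fin n → ℝ ↦ (∑ j, w j) * |C|)
        (nhdsWithin w {w | ∀ i, 0 ≤ w i}) (nhds 0) := by
      have := ((hmass.mul (continuous_const (y := |C|))).tendsto w).mono_left
        (nhdsWithin_le_nhds (s := {w | ∀ i, 0 ≤ w i}))
      rwa [Pi.mul_apply, h, zero_mul] at this
    refine squeeze_zero_norm' ?_ hlim
    filter_upwards [self_mem_nhdsWithin] with v hv
    have hs : 0 ≤ ∑ j, v j := Finset.sum_nonneg fun j _ ↦ hv j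
    by_cases hv0 : ∑ j, v j = 0
    · simp [homogenize, hv0]
    · rw [homogenize, norm_mul, Real.norm_of_nonneg hs]
      exact mul_le_mul_of_nonneg_left
        ((hC _ (normalize_mem_stdSimplex hv hv0)).trans (le_abs_self C)) hs
  · have hopen : {w : Fin n → ℝ | ∑ j, w j ≠ 0} ∈ nhds w :=
      (isOpen_ne_fun hmass continuous_const).mem_nhds h
    rw [← continuousWithinAt_inter hopen]
    have hn : ContinuousOn (normalize (n := n)) ({w | ∀ i, 0 ≤ w i} ∩ {w | ∑ j, w j ≠ 0}) :=
      continuousOn_pi.2 fun i ↦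
        (continuous_apply i).continuousOn.div hmass.continuousOn fun v hv ↦ hv.2
    exact (hmass.continuousOn.mul
      (hφ.comp hn fun v hv ↦ normalize_mem_stdSimplex hv.1 hv.2)) w ⟨hw, h⟩

/-- The elementary symmetric function detecting points with more than `S` nonzero coordinates. -/
noncomputable def spread (S : ℕ) (y : Fin n → ℝ) : ℝ :=
  ∑ T ∈ Finset.univ.powersetCard (S + 1), ∏ i ∈ T, y i

lemma continuous_spread (S : ℕ) : Continuous (spread S : (Fin n → ℝ) → ℝ) :=
  continuous_finsetSum _ fun _ _ ↦ continuous_finsetProd _ fun i _ ↦ continuous_apply i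

lemma spread_eq_zero_iff {S : ℕ} {y : Fin n → ℝ} (hy : ∀ i, 0 ≤ y i) :
    spread S y = 0 ↔ (Finset.univ.filter fun i ↦ y i ≠ 0).card ≤ S := by
  rw [spread, Finset.sum_eq_zero_iff_of_nonneg fun T _ ↦ Finset.prod_nonneg fun i _ ↦ hy i]
  constructor
  · intro h
    by_contra! hc
    obtain ⟨T, hT, hcard⟩ := Finset.exists_subset_card_eq (Nat.succ_le_of_lt hc)
    obtain ⟨i, hi, h0⟩ := Finset.prod_eq_zero_iff.1
      (h T (Finset.mem_powersetCard.2 ⟨Finset.subset_univ _, hcard⟩))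
    exact (Finset.mem_filter.1 (hT hi)).2 h0
  · intro h T hT
    by_contra h0
    have : T ⊆ Finset.univ.filter fun i ↦ y i ≠ 0 := fun i hi ↦
      Finset.mem_filter.2 ⟨Finset.mem_univ _, Finset.prod_ne_zero_iff.1 h0 i hi⟩
    have h1 := Finset.card_le_card this
    have h2 := (Finset.mem_powersetCard.1 hT).2
    omega

lemma exists_disjoint_superset {ι α : Type*} [Fintype ι] [Fintype α] {S : ℕ}
    (hS : Fintype.card ι * S ≤ Fintype.card α) {B : ι → Finset α}
    (hB : Pairwise fun i j ↦ Disjoint (B i) (B j)) (hcard : ∀ i, (B i).card ≤ S) :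
    ∃ A : ι → Finset α, (Pairwise fun i j ↦ Disjoint (A i) (A j)) ∧ (∀ i, B i ⊆ A i) ∧
      ∀ i, (A i).card = S := by
  classical
  suffices H : ∀ J : Finset ι, ∃ A : ι → Finset α, (Pairwise fun i j ↦ Disjoint (A i) (A j)) ∧
      (∀ i, B i ⊆ A i) ∧ (∀ i, (A i).card ≤ S) ∧ ∀ i ∈ J, (A i).card = S by
    obtain ⟨A, h1, h2, -, h3⟩ := H Finset.univ
    exact ⟨A, h1, h2, fun i ↦ h3 i (Finset.mem_univ i)⟩
  intro J
  induction J using Finset.induction_on with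
  | empty => exact ⟨B, hB, fun i ↦ subset_rfl, hcard, by simp⟩
  | insert j J _ ih =>
    obtain ⟨A, h1, h2, h3, h4⟩ := ih
    let U := (Finset.univ.erase j).biUnion A
    have hU : U.card ≤ (Fintype.card ι - 1) * S := by
      have := Finset.card_biUnion_le_card_mul (Finset.univ.erase j) A S fun i _ ↦ h3 i
      rwa [Finset.card_erase_of_mem (Finset.mem_univ j), Finset.card_univ] at this
    have hpos : 0 < Fintype.card ι := Fintype.card_pos_iff.2 ⟨j⟩
    have hUc : S ≤ Uᶜ.card := by
      rw [Finset.card_compl]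
      have : Fintype.card ι * S = (Fintype.card ι - 1) * S + S := by
        obtain ⟨t, ht⟩ := Nat.exists_eq_succ_of_ne_zero hpos.ne'
        rw [ht, Nat.succ_sub_one, Nat.succ_mul]
      omega
    have hAU : A j ⊆ Uᶜ := by
      intro a ha
      simp only [U, Finset.mem_compl, Finset.mem_biUnion, Finset.mem_erase, not_exists, not_and]
      exact fun i hi hai ↦ Finset.disjoint_left.1 (h1 hi.1) hai ha
    obtain ⟨C, hC1, hC2, hC3⟩ := Finset.exists_subsuperset_card_eq hAU (h3 j) hUc
    have hdis (i : ι) (hi : i ≠ j) : Disjoint C (A i) := by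
      rw [Finset.disjoint_left]
      intro a ha hai
      exact Finset.mem_compl.1 (hC2 ha)
        (Finset.mem_biUnion.2 ⟨i, Finset.mem_erase.2 ⟨hi, Finset.mem_univ i⟩, hai⟩)
    refine ⟨Function.update A j C, ?_, ?_, ?_, ?_⟩
    · intro a b hab
      by_cases ha : a = j
      · subst ha
        simpa [Function.update_of_ne hab.symm] using hdis b hab.symm
      · by_cases hb : b = j
        · subst hb
          simpa [Function.update_of_ne ha] using (hdis a ha).symm
        · simpa [Function.update_of_ne ha, Function.update_of_ne hb] using h1 hab
    · intro i
      by_cases hi : i = j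
      · subst hi
        simpa using (h2 i).trans hC1
      · simpa [Function.update_of_ne hi] using h2 i
    · intro i
      by_cases hi : i = j
      · subst hi
        simp [hC3]
      · simpa [Function.update_of_ne hi] using h3 i
    · intro i hi
      by_cases hij : i = j
      · subst hij
        simpa using hC3
      · simpa [Function.update_of_ne hij] using h4 i ((Finset.mem_insert.1 hi).resolve_left hij)

theorem exists_points {p m d S N : ℕ} [Fact p.Prime] (hN : N = (d + 2) * (p ^ m - 1))
    (hd : p = 2 → Even d) (hS : N + 1 < p ^ m * (S + 1))
    {f : (Fin (N + 1) → ℝ) → EuclideanSpace ℝ (Fin d)}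
    (hf : ContinuousOn f (stdSimplex ℝ (Fin (N + 1)))) :
    ∃ y : (Fin m → ZMod p) → Fin (N + 1) → ℝ, (∀ g, y g ∈ stdSimplex ℝ (Fin (N + 1))) ∧
      (∀ i g h, g ≠ h → y g i * y h i = 0) ∧ (∀ g h, f (y g) = f (y h)) ∧
      ∀ g, (Finset.univ.filter fun i ↦ y g i ≠ 0).card ≤ S := by
  classical
  let G := Fin m → ZMod p
  have hG : Fintype.card G = p ^ m := by
    rw [Fintype.card_fun, ZMod.card, Fintype.card_fin]
  let Ψ (x : joinSet G (N + 1)) (g : G) : Fin (d + 2) → ℝ :=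
    Fin.append (fun l ↦ homogenize (fun y ↦ f y l) (x.1 g))
      ![∑ j, x.1 g j, homogenize (spread S) (x.1 g)]
  have hcoord (g : G) : Continuous fun x : joinSet G (N + 1) ↦ x.1 g :=
    (continuous_apply g).comp continuous_subtype_val
  have hhom {φ : (Fin (N + 1) → ℝ) → ℝ} (hφ : ContinuousOn φ (stdSimplex ℝ (Fin (N + 1))))
      (g : G) : Continuous fun x : joinSet G (N + 1) ↦ homogenize φ (x.1 g) :=
    (continuousOn_homogenize hφ).comp_continuous (hcoord g) fun x ↦ x.2.1 g
  have hΨ (g : G) : Continuous fun x ↦ Ψ x g := by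
    refine continuous_pi fun l ↦ ?_
    refine Fin.addCases (fun l ↦ ?_) (fun l ↦ ?_) l
    · simp only [Ψ, Fin.append_left]
      refine hhom ?_ g
      exact (EuclideanSpace.proj (𝕜 := ℝ) l).continuous.comp_continuousOn hf
    · simp only [Ψ, Fin.append_right]
      fin_cases l
      · change Continuous fun x : joinSet G (N + 1) ↦ ∑ j, x.1 g j
        exact continuous_finsetSum _ fun j _ ↦ (continuous_apply j).comp (hcoord g)
      · exact hhom (continuous_spread S).continuousOn g
  have he (h : G) (x : joinSet G (N + 1)) (g : G) : Ψ (h +ᵥ x) g = Ψ x (g - h) := rfl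
  obtain ⟨x, hx⟩ := exists_constant hN (fun h ↦ (hd h).add even_two) hΨ he
  have hmass (g h : G) : ∑ j, x.1 g j = ∑ j, x.1 h j := by
    have := congrFun (hx g h) (Fin.natAdd d 0)
    simpa [Ψ] using this
  have hspread (g h : G) : homogenize (spread S) (x.1 g) = homogenize (spread S) (x.1 h) := by
    have := congrFun (hx g h) (Fin.natAdd d 1)
    simpa [Ψ] using this
  have hfl (g h : G) (l : Fin d) :
      homogenize (fun y ↦ f y l) (x.1 g) = homogenize (fun y ↦ f y l) (x.1 h) := by
    have := congrFun (hx g h) (Fin.castAdd 2 l)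
    simpa [Ψ] using this
  have hm0 (g : G) : ∑ j, x.1 g j ≠ 0 := by
    intro h0
    have h1 : ∑ g, ∑ j, x.1 g j = 1 := x.2.2.1
    rw [Finset.sum_eq_zero fun h _ ↦ (hmass h g).trans h0] at h1
    exact zero_ne_one h1
  have hval {φ : (Fin (N + 1) → ℝ) → ℝ} {g h : G}
      (hφ : homogenize φ (x.1 g) = homogenize φ (x.1 h)) :
      φ (normalize (x.1 g)) = φ (normalize (x.1 h)) := by
    unfold homogenize at hφ
    rw [hmass h g] at hφ
    exact mul_left_cancel₀ (hm0 g) hφ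
  have hsimp (g : G) := normalize_mem_stdSimplex (x.2.1 g) (hm0 g)
  have hdisj (i : Fin (N + 1)) (g h : G) (hgh : g ≠ h) :
      normalize (x.1 g) i * normalize (x.1 h) i = 0 := by
    rw [normalize, normalize, div_mul_div_comm, x.2.2.2 i g h hgh, zero_div]
  refine ⟨fun g ↦ normalize (x.1 g), hsimp, hdisj, fun g h ↦ ?_, ?_⟩
  · ext l
    exact hval (hfl g h l)
  · obtain ⟨g₀, hg₀⟩ : ∃ g : G, (Finset.univ.filter fun i ↦ normalize (x.1 g) i ≠ 0).card ≤ S := by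
      by_contra! hc
      have h1 : ∑ _g : G, (S + 1) ≤
          ∑ g : G, (Finset.univ.filter fun i ↦ normalize (x.1 g) i ≠ 0).card :=
        Finset.sum_le_sum fun g _ ↦ hc g
      rw [← Finset.card_biUnion, Finset.sum_const, Finset.card_univ, hG, smul_eq_mul] at h1
      · have h2 := h1.trans (Finset.card_le_univ _)
        rw [Fintype.card_fin] at h2
        omega
      · intro g _ h _ hgh
        refine Finset.disjoint_left.2 fun i hi hi' ↦ ?_
        exact mul_ne_zero (Finset.mem_filter.1 hi).2 (Finset.mem_filter.1 hi').2 (hdisj i g h hgh)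
    intro g
    rw [← spread_eq_zero_iff (hsimp g).1, hval (hspread g g₀), spread_eq_zero_iff (hsimp g₀).1]
    exact hg₀

end TestMap

end VanKampenFlores

open VanKampenFlores

/-- `r`-fold van Kampen–Flores theorem for prime powers: if `r` is a prime power and
`k > 0`, then for every continuous map of the `(kr+2)(r-1)`-simplex to `ℝ^{kr}` there
exist `r` pairwise disjoint `k(r-1)`-dimensional faces whose images have a common
point. -/
theorem stmt_17 (r k : ℕ) (hk : 0 < k)
    (hr : ∃ q m : ℕ, Nat.Prime q ∧ 1 ≤ m ∧ r = q ^ m)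
    (f : (Fin ((k * r + 2) * (r - 1) + 1) → ℝ) → EuclideanSpace ℝ (Fin (k * r)))
    (hf : ContinuousOn f (stdSimplex ℝ (Fin ((k * r + 2) * (r - 1) + 1)))) :
    ∃ A : Fin r → Finset (Fin ((k * r + 2) * (r - 1) + 1)),
      (∀ s t : Fin r, s ≠ t → Disjoint (A s) (A t)) ∧
      (∀ s : Fin r, (A s).card = k * (r - 1) + 1) ∧
      (⋂ s : Fin r,
        f '' {x ∈ stdSimplex ℝ (Fin ((k * r + 2) * (r - 1) + 1)) |
          ∀ i ∉ A s, x i = 0}).Nonempty := by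
  obtain ⟨p, m, hp, hm, rfl⟩ := hr
  have : Fact p.Prime := ⟨hp⟩
  have hr0 : 0 < p ^ m := pow_pos hp.pos m
  obtain ⟨t, ht⟩ := Nat.exists_eq_succ_of_ne_zero hr0.ne'
  have hcard : Fintype.card (Fin m → ZMod p) = p ^ m := by
    rw [Fintype.card_fun, ZMod.card, Fintype.card_fin]
  obtain ⟨y, hy1, hy2, hy3, hy4⟩ := exists_points (p := p) (m := m) (d := k * p ^ m)
    (S := k * (p ^ m - 1) + 1) rfl
    (fun h ↦ ((even_iff_two_dvd.2 (h ▸ dvd_rfl : 2 ∣ p)).pow_of_ne_zero (by omega)).mul_left k)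
    (by
      rw [ht, Nat.succ_sub_one]
      ring_nf
      omega) hf
  let e : Fin (p ^ m) ≃ (Fin m → ZMod p) := (Fintype.equivFinOfCardEq hcard).symm
  obtain ⟨A, hA1, hA2, hA3⟩ := exists_disjoint_superset (ι := Fin (p ^ m))
    (α := Fin ((k * p ^ m + 2) * (p ^ m - 1) + 1)) (S := k * (p ^ m - 1) + 1)
    (by
      rw [Fintype.card_fin, Fintype.card_fin, ht, Nat.succ_sub_one]
      ring_nf
      omega)
    (B := fun s ↦ Finset.univ.filter fun i ↦ y (e s) i ≠ 0)
    (fun a b hab ↦ Finset.disjoint_left.2 fun i hi hi' ↦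
      mul_ne_zero (Finset.mem_filter.1 hi).2 (Finset.mem_filter.1 hi').2
        (hy2 i _ _ (e.injective.ne hab)))
    (fun s ↦ hy4 (e s))
  refine ⟨A, fun s t hst ↦ hA1 hst, hA3, f (y 0), Set.mem_iInter.2 fun s ↦ ?_⟩
  refine ⟨y (e s), ⟨hy1 _, fun i hi ↦ ?_⟩, hy3 _ _⟩
  by_contra h0
  exact hi (hA2 s (Finset.mem_filter.2 ⟨Finset.mem_univ i, h0⟩))
end

section
/- (Topological non-planarity of K₅.) Let p : Fin 5 → ℝ² be any 5 points in the plane, and for each unordered pair of distinct indices i < j let γ_{ij} : [0,1] → ℝ² be a continuous path with γ_{ij}(0) = p i and γ_{ij}(1) = p j (a drawing of the edge {i,j} of the complete graph K₅). Then there exist four pairwise distinct indices i, j, k, l such that the images of the paths drawing the two non-adjacent edges {i,j} and {k,l} intersect: Set.range γ_{ij} ∩ Set.range γ_{kl} is nonempty. -/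
open Complex

/-- A nowhere vanishing continuous function on a simply connected, locally path connected space
has a continuous logarithm. -/
theorem exists_continuous_exp_eq {X : Type*} [TopologicalSpace X] [SimplyConnectedSpace X]
    [LocallyPathConnectedSpace X] {f : X → ℂ} (hf : Continuous f) (h0 : ∀ x, f x ≠ 0) :
    ∃ g : X → ℂ, Continuous g ∧ ∀ x, exp (g x) = f x := by
  obtain ⟨x₀⟩ : Nonempty X := inferInstance
  obtain ⟨g, ⟨-, hg⟩, -⟩ := isCoveringMapOn_exp.existsUnique_continuousMap_lifts
    ⟨f, hf⟩ (a₀ := x₀) (exp_log (h0 x₀)) h0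
  exact ⟨g, g.continuous, congrFun hg⟩

/-- Continuous logarithms of proportional functions on `ℝ` differ by a constant. -/
theorem sub_eq_sub_of_exp_eq_mul {f g : ℝ → ℂ} (hf : Continuous f) (hg : Continuous g) (c : ℂ)
    (h : ∀ t, exp (f t) = c * exp (g t)) (a b : ℝ) : f b - f a = g b - g a := by
  have key := isCoveringMap_exp.const_of_comp (g := fun t ↦ f t - g t) (hf.sub hg)
    (fun s t ↦ Subtype.ext (by simp [exp_sub, h, exp_ne_zero])) b a
  linear_combination key

open Classical in
/-- The change over `[0, 1]` of a continuous logarithm of `f`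
(zero if `f` has no continuous logarithm). -/
noncomputable def logChange (f : ℝ → ℂ) : ℂ :=
  if h : ∃ g : ℝ → ℂ, Continuous g ∧ ∀ t, exp (g t) = f t then h.choose 1 - h.choose 0 else 0

theorem logChange_eq {f g : ℝ → ℂ} (hg : Continuous g) (c : ℂ)
    (h : ∀ t, exp (g t) = c * f t) (hc : c ≠ 0) : logChange f = g 1 - g 0 := by
  have hex : ∃ g : ℝ → ℂ, Continuous g ∧ ∀ t, exp (g t) = f t :=
    ⟨fun t ↦ g t - log c, by fun_prop, fun t ↦ by
      rw [exp_sub, exp_log hc, h, mul_div_cancel_left₀ _ hc]⟩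
  rw [logChange, dif_pos hex]
  refine sub_eq_sub_of_exp_eq_mul hex.choose_spec.1 hg c⁻¹ (fun t ↦ ?_) 0 1
  rw [hex.choose_spec.2, h, inv_mul_cancel_left₀ hc]

theorem exp_logChange_mul {f : ℝ → ℂ} (hf : Continuous f) (h0 : ∀ t, f t ≠ 0) :
    exp (logChange f) * f 0 = f 1 := by
  obtain ⟨g, hg, h⟩ := exists_continuous_exp_eq hf h0
  rw [logChange_eq hg 1 (by simpa using h) one_ne_zero, exp_sub, h, h, div_mul_cancel₀ _ (h0 0)]

/-- The logarithmic changes along the boundary of a square cancel, for the difference of two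
functions with disjoint ranges. -/
theorem logChange_square {f g : ℝ → ℂ} (hf : Continuous f) (hg : Continuous g)
    (h : ∀ s t, f s ≠ g t) :
    logChange (fun s ↦ f s - g 0) + logChange (fun t ↦ g t - f 1) =
      logChange (fun t ↦ g t - f 0) + logChange (fun s ↦ f s - g 1) := by
  obtain ⟨L, hL, hexp⟩ := exists_continuous_exp_eq (X := ℝ × ℝ) (f := fun x ↦ f x.1 - g x.2)
    (by fun_prop) (fun x ↦ sub_ne_zero.2 (h _ _))
  have h1 (t : ℝ) := logChange_eq (f := fun s ↦ f s - g t) (g := fun s ↦ L (s, t))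
    (by fun_prop) 1 (by simp [hexp]) one_ne_zero
  have h2 (s : ℝ) := logChange_eq (f := fun t ↦ g t - f s) (g := fun t ↦ L (s, t))
    (by fun_prop) (-1) (by simp [hexp]) (by simp)
  rw [h1, h1, h2, h2]
  ring

/-- The parity obstruction to embedding `K₅` in the plane. -/
theorem not_exists_square_relation_fin_five (n : Fin 5 → Fin 5 → Fin 5 → ℤ)
    (h : ∀ i j k l : Fin 5, i < j → k < l → i ≠ k → i ≠ l → j ≠ k → j ≠ l →
      2 * (n k i j + n j k l - n i k l - n l i j) + (if j < k then 1 else -1) +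
        (if k < i then 1 else -1) + (if l < j then 1 else -1) + (if i < l then 1 else -1) = 0) :
    False := by
  have h₁ := h 0 1 2 3
  have h₂ := h 0 1 2 4
  have h₃ := h 0 1 3 4
  have h₄ := h 0 2 1 3
  have h₅ := h 0 2 1 4
  have h₆ := h 0 2 3 4
  have h₇ := h 0 3 1 2
  have h₈ := h 0 3 1 4
  have h₉ := h 0 3 2 4
  have h₁₀ := h 0 4 1 2
  have h₁₁ := h 0 4 1 3
  have h₁₂ := h 0 4 2 3
  have h₁₃ := h 1 2 3 4
  have h₁₄ := h 1 3 2 4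
  have h₁₅ := h 1 4 2 3
  simp +decide at h₁ h₂ h₃ h₄ h₅ h₆ h₇ h₈ h₉ h₁₀ h₁₁ h₁₂ h₁₃ h₁₄ h₁₅
  clear h
  omega

/-- There is no system of logarithmic changes along the edges of `K₅` seen from the other
vertices that is compatible with all pairs of non-adjacent edges. -/
theorem not_exists_log_system_fin_five (P : Fin 5 → ℂ) (hP : Function.Injective P)
    (W : Fin 5 → Fin 5 → Fin 5 → ℂ)
    (hexp : ∀ k i j, i < j → k ≠ i → k ≠ j → exp (W k i j) * (P i - P k) = P j - P k)
    (hsq : ∀ i j k l : Fin 5, i < j → k < l → i ≠ k → i ≠ l → j ≠ k → j ≠ l →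
      W k i j + W j k l = W i k l + W l i j) : False := by
  obtain ⟨z, hz, hzz⟩ : ∃ z : Fin 5 → Fin 5 → ℂ, (∀ a b, a ≠ b → exp (z a b) = P b - P a) ∧
      ∀ a b, a ≠ b → z a b - z b a = ((if b < a then 1 else -1 : ℤ) : ℂ) * (Real.pi * I) := by
    refine ⟨fun a b ↦ if a < b then log (P b - P a) else log (P a - P b) + Real.pi * I,
      fun a b hab ↦ ?_, fun a b hab ↦ ?_⟩
    · dsimp only
      have h1 := sub_ne_zero.2 (hP.ne hab)
      have h2 := sub_ne_zero.2 (hP.ne hab.symm)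
      split_ifs
      · exact exp_log h2
      · rw [exp_add, exp_log h1, exp_pi_mul_I]
        ring
    · rcases lt_or_gt_of_ne hab with h | h <;> simp [h, h.not_gt]
  have hn (k i j : Fin 5) : ∃ n : ℤ, i < j → k ≠ i → k ≠ j →
      W k i j = z k j - z k i + n * (2 * Real.pi * I) := by
    by_cases h : i < j ∧ k ≠ i ∧ k ≠ j
    · obtain ⟨n, hn⟩ := exp_eq_exp_iff_exists_int.1
        (show exp (W k i j) = exp (z k j - z k i) by
          rw [exp_sub, hz _ _ h.2.1, hz _ _ h.2.2, ← hexp k i j h.1 h.2.1 h.2.2,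
            mul_div_cancel_right₀ _ (sub_ne_zero.2 (hP.ne h.2.1.symm))])
      exact ⟨n, fun _ _ _ ↦ hn⟩
    · exact ⟨0, fun h1 h2 h3 ↦ (h ⟨h1, h2, h3⟩).elim⟩
  choose n hn using hn
  refine not_exists_square_relation_fin_five n fun i j k l hij hkl hik hil hjk hjl ↦ ?_
  have h := hsq i j k l hij hkl hik hil hjk hjl
  rw [hn k i j hij hik.symm hjk.symm, hn j k l hkl hjk hjl, hn i k l hkl hik hil,
    hn l i j hij hil.symm hjl.symm] at h
  have hpi : (Real.pi * I : ℂ) ≠ 0 := by simp [Real.pi_ne_zero]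
  rw [← Int.cast_inj (α := ℂ)]
  refine mul_right_cancel₀ hpi ?_
  have e1 := hzz k j hjk.symm
  have e2 := hzz i k hik
  have e3 := hzz j l hjl
  have e4 := hzz l i hil.symm
  push_cast at e1 e2 e3 e4 ⊢
  linear_combination h - e1 - e2 - e3 - e4

/-- Topological non-planarity of `K₅`: for any drawing of the edges of `K₅` in the plane
by continuous paths, the images of two non-adjacent edges intersect. -/
theorem stmt_18 (p : Fin 5 → EuclideanSpace ℝ (Fin 2))
    (γ : ∀ i j : Fin 5, i < j → Path (p i) (p j)) :
    ∃ (i j k l : Fin 5) (hij : i < j) (hkl : k < l),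
      i ≠ k ∧ i ≠ l ∧ j ≠ k ∧ j ≠ l ∧
      (Set.range ⇑(γ i j hij) ∩ Set.range ⇑(γ k l hkl)).Nonempty := by
  by_contra! hcon
  let φ := orthonormalBasisOneI.repr.symm
  let c : Fin 5 → Fin 5 → ℝ → ℂ := fun i j t ↦ if h : i < j then φ ((γ i j h).extend t) else 0
  have c_eq {i j : Fin 5} (h : i < j) : c i j = fun t ↦ φ ((γ i j h).extend t) := by
    ext t
    simp [c, h]
  have c_cont {i j : Fin 5} (h : i < j) : Continuous (c i j) := by
    rw [c_eq h]
    fun_prop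
  have c_zero {i j : Fin 5} (h : i < j) : c i j 0 = φ (p i) := by simp [c_eq h]
  have c_one {i j : Fin 5} (h : i < j) : c i j 1 = φ (p j) := by simp [c_eq h]
  have c_ne {i j k l : Fin 5} (hij : i < j) (hkl : k < l) (hik : i ≠ k) (hil : i ≠ l)
      (hjk : j ≠ k) (hjl : j ≠ l) (s t : ℝ) : c i j s ≠ c k l t := by
    rw [c_eq hij, c_eq hkl]
    refine fun h ↦ Set.notMem_empty ((γ i j hij).extend s) ?_
    rw [← hcon i j k l hij hkl hik hil hjk hjl, ← Path.extend_range, ← Path.extend_range]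
    exact ⟨⟨s, rfl⟩, ⟨t, (φ.injective h).symm⟩⟩
  have c_ne_vertex {i j k : Fin 5} (hij : i < j) (hki : k ≠ i) (hkj : k ≠ j) (t : ℝ) :
      c i j t ≠ φ (p k) := by
    obtain ⟨l, hli, hlj, hlk⟩ : ∃ l : Fin 5, l ≠ i ∧ l ≠ j ∧ l ≠ k := by
      clear * -
      decide +revert
    rcases lt_or_gt_of_ne hlk with h | h
    · rw [← c_one h]
      exact c_ne hij h hli.symm hki.symm hlj.symm hkj.symm _ _
    · rw [← c_zero h]
      exact c_ne hij h hki.symm hli.symm hkj.symm hlj.symm _ _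
  have hinj : Function.Injective fun i ↦ φ (p i) := by
    intro a b hab
    by_contra hne
    obtain ⟨l, hla, hlb⟩ : ∃ l : Fin 5, l ≠ a ∧ l ≠ b := by
      clear * -
      decide +revert
    rcases lt_or_gt_of_ne hla with h | h
    · exact c_ne_vertex h hlb.symm (Ne.symm hne) 1 ((c_one h).trans hab)
    · exact c_ne_vertex h (Ne.symm hne) hlb.symm 0 ((c_zero h).trans hab)
  refine not_exists_log_system_fin_five _ hinj
    (fun k i j ↦ logChange fun t ↦ c i j t - φ (p k)) (fun k i j hij hki hkj ↦ ?_)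
    (fun i j k l hij hkl hik hil hjk hjl ↦ ?_)
  · have := exp_logChange_mul (f := fun t ↦ c i j t - φ (p k)) ((c_cont hij).sub continuous_const)
      fun t ↦ sub_ne_zero.2 (c_ne_vertex hij hki hkj t)
    rwa [c_zero hij, c_one hij] at this
  · have := logChange_square (c_cont hij) (c_cont hkl) (c_ne hij hkl hik hil hjk hjl)
    rwa [c_zero hij, c_one hij, c_zero hkl, c_one hkl] at this
end

section
/- (Borsuk–Ulam theorem.) Let d be a positive integer and let f be a continuous map from the unit sphere S^d = Metric.sphere (0 : EuclideanSpace ℝ (Fin (d+1))) 1 to EuclideanSpace ℝ (Fin d). Then there exists a point x ∈ S^d such that f(x) = f(−x). -/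
namespace BorsukUlam

/-- Ordered chains modulo two on `V`, of all dimensions at once; a list of length `k + 1` is an
ordered `k`-simplex and the empty list is the augmentation. -/
abbrev Chain (V : Type*) := List V →₀ ZMod 2

section Boundary

variable {V : Type*}

/-- The linear map on chains adding the apex `v` in front of each list. -/
noncomputable def cone (v : V) : Chain V →ₗ[ZMod 2] Chain V :=
  Finsupp.linearCombination (ZMod 2) fun l => Finsupp.single (v :: l) 1

/-- The boundary of a single ordered simplex. -/
noncomputable def listBoundary : List V → Chain V
  | [] => 0
  | v :: l => Finsupp.single l 1 + cone v (listBoundary l)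

/-- The (augmented) boundary operator. -/
noncomputable def boundary : Chain V →ₗ[ZMod 2] Chain V :=
  Finsupp.linearCombination (ZMod 2) listBoundary

@[simp] lemma cone_single (v : V) (l : List V) :
    cone v (Finsupp.single l 1) = Finsupp.single (v :: l) 1 := by
  simp [cone]

@[simp] lemma boundary_single (l : List V) :
    boundary (Finsupp.single l 1) = listBoundary l := by
  simp [boundary]

/-- Linear maps on chains agree once they agree on simplices. -/
lemma chain_hom_ext {M : Type*} [AddCommGroup M] [Module (ZMod 2) M]
    {f g : Chain V →ₗ[ZMod 2] M}
    (h : ∀ l, f (Finsupp.single l 1) = g (Finsupp.single l 1)) : f = g := by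
  refine Finsupp.lhom_ext' fun l => LinearMap.ext_ring ?_
  simpa using h l

lemma boundary_cone (v : V) (c : Chain V) :
    boundary (cone v c) = c + cone v (boundary c) := by
  have : boundary ∘ₗ cone v = LinearMap.id + cone v ∘ₗ boundary :=
    chain_hom_ext fun l => by simp [listBoundary]
  exact LinearMap.congr_fun this c

lemma boundary_listBoundary (l : List V) : boundary (listBoundary l) = 0 := by
  induction l with
  | nil => simp [listBoundary]
  | cons v l ih => simp [listBoundary, boundary_cone, ih, ZModModule.add_self]

lemma boundary_boundary (c : Chain V) : boundary (boundary c) = 0 := by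
  have : boundary ∘ₗ boundary = (0 : Chain V →ₗ[ZMod 2] Chain V) :=
    chain_hom_ext fun l => by simp [boundary_listBoundary]
  exact LinearMap.congr_fun this c

/-- A linear map sends chains supported in `P` to a submodule as soon as it does so on
simplices. -/
lemma map_mem_of_supported {M : Type*} [AddCommGroup M] [Module (ZMod 2) M]
    {f : Chain V →ₗ[ZMod 2] M} {P : Set (List V)} {Q : Submodule (ZMod 2) M}
    (h : ∀ l ∈ P, f (Finsupp.single l 1) ∈ Q) {c : Chain V}
    (hc : c ∈ Finsupp.supported (ZMod 2) (ZMod 2) P) : f c ∈ Q := by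
  rw [Finsupp.supported_eq_span_single] at hc
  have : Submodule.span (ZMod 2) ((fun l => Finsupp.single l (1 : ZMod 2)) '' P) ≤ Q.comap f := by
    rw [Submodule.span_le]
    rintro _ ⟨l, hl, rfl⟩
    exact h l hl
  exact this hc

lemma cone_mem_supported {v : V} {P Q : Set (List V)} (h : ∀ l ∈ P, v :: l ∈ Q) {c : Chain V}
    (hc : c ∈ Finsupp.supported (ZMod 2) (ZMod 2) P) :
    cone v c ∈ Finsupp.supported (ZMod 2) (ZMod 2) Q :=
  map_mem_of_supported
    (fun l hl => by simpa using Finsupp.single_mem_supported (ZMod 2) 1 (h l hl)) hc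

lemma listBoundary_mem_supported (l : List V) : listBoundary l ∈
    Finsupp.supported (ZMod 2) (ZMod 2) {l' : List V | l'.length + 1 = l.length ∧ l' ⊆ l} := by
  induction l with
  | nil => simp [listBoundary]
  | cons v l ih =>
    refine add_mem (Finsupp.single_mem_supported _ _ ?_) (cone_mem_supported ?_ ih)
    · simp
    · rintro l' ⟨h1, h2⟩
      refine ⟨by simp [h1], List.cons_subset_cons v h2⟩

end Boundary

section Antipode

variable {V : Type*} [AddCommGroup V]

/-- The antipodal action on chains. -/
noncomputable def antipode : Chain V →ₗ[ZMod 2] Chain V :=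
  Finsupp.linearCombination (ZMod 2) fun l => Finsupp.single (l.map Neg.neg) 1

@[simp] lemma antipode_single (l : List V) :
    antipode (Finsupp.single l 1) = Finsupp.single (l.map Neg.neg) 1 := by
  simp [antipode]

lemma antipode_cone (v : V) (c : Chain V) : antipode (cone v c) = cone (-v) (antipode c) := by
  have : antipode ∘ₗ cone v = cone (-v) ∘ₗ antipode := chain_hom_ext fun l => by simp
  exact LinearMap.congr_fun this c

lemma antipode_antipode (c : Chain V) : antipode (antipode c) = c := by
  have : antipode ∘ₗ antipode = (LinearMap.id : Chain V →ₗ[ZMod 2] Chain V) :=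
    chain_hom_ext fun l => by simp
  exact LinearMap.congr_fun this c

lemma antipode_listBoundary (l : List V) :
    antipode (listBoundary l) = listBoundary (l.map Neg.neg) := by
  induction l with
  | nil => simp [listBoundary]
  | cons v l ih => simp [listBoundary, antipode_cone, ih]

lemma antipode_boundary (c : Chain V) : antipode (boundary c) = boundary (antipode c) := by
  have : antipode ∘ₗ boundary = boundary ∘ₗ (antipode : Chain V →ₗ[ZMod 2] Chain V) :=
    chain_hom_ext fun l => by simp [antipode_listBoundary]
  exact LinearMap.congr_fun this c

/-- The hemispheres of the cross-polytope with vertices `± e i`. -/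
noncomputable def hemisphere (e : ℕ → V) : ℕ → Chain V
  | 0 => Finsupp.single [e 0] 1
  | k + 1 => cone (e (k + 1)) (hemisphere e k + antipode (hemisphere e k))

lemma boundary_hemisphere (e : ℕ → V) (k : ℕ) :
    boundary (hemisphere e (k + 1)) = hemisphere e k + antipode (hemisphere e k) := by
  have hz : boundary (hemisphere e k + antipode (hemisphere e k)) = 0 := by
    rw [map_add, ← antipode_boundary]
    cases k with
    | zero => simp [hemisphere, listBoundary, ZModModule.add_self]
    | succ k =>
      rw [boundary_hemisphere e k, map_add, antipode_antipode, add_comm (antipode _),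
        ZModModule.add_self]
  rw [hemisphere, boundary_cone, hz, map_zero, add_zero]

end Antipode

section Cochains

variable {V : Type*}

/-- The cup product of the coboundaries of `s (k - 1), …, s 0`, evaluated on a list. -/
def listCup (s : ℕ → V → ZMod 2) : ℕ → List V → ZMod 2
  | 0, [_] => 1
  | k + 1, a :: b :: l => (s k a + s k b) * listCup s k (b :: l)
  | _, _ => 0

/-- The cup product of the coboundaries of `s (k - 1), …, s 0`, as a functional on chains. -/
noncomputable def cup (s : ℕ → V → ZMod 2) (k : ℕ) : Chain V →ₗ[ZMod 2] ZMod 2 :=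
  Finsupp.linearCombination (ZMod 2) (listCup s k)

/-- The cup product of `s k` with the coboundaries of `s (k - 1), …, s 0`, on a list. -/
def listHalfCup (s : ℕ → V → ZMod 2) (k : ℕ) : List V → ZMod 2
  | [] => 0
  | a :: l => s k a * listCup s k (a :: l)

/-- The cup product of `s k` with the coboundaries of `s (k - 1), …, s 0`, on chains. -/
noncomputable def halfCup (s : ℕ → V → ZMod 2) (k : ℕ) : Chain V →ₗ[ZMod 2] ZMod 2 :=
  Finsupp.linearCombination (ZMod 2) (listHalfCup s k)

variable (s : ℕ → V → ZMod 2)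

@[simp] lemma cup_single (k : ℕ) (l : List V) :
    cup s k (Finsupp.single l 1) = listCup s k l := by simp [cup]

@[simp] lemma halfCup_single (k : ℕ) (l : List V) :
    halfCup s k (Finsupp.single l 1) = listHalfCup s k l := by simp [halfCup]

@[simp] lemma listCup_nil (k : ℕ) : listCup s k [] = 0 := by cases k <;> rfl

@[simp] lemma listCup_zero_singleton (a : V) : listCup s 0 [a] = 1 := rfl

@[simp] lemma listCup_succ_singleton (k : ℕ) (a : V) : listCup s (k + 1) [a] = 0 := rfl

@[simp] lemma listCup_zero_cons_cons (a b : V) (l : List V) : listCup s 0 (a :: b :: l) = 0 := rfl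

@[simp] lemma listCup_succ_cons_cons (k : ℕ) (a b : V) (l : List V) :
    listCup s (k + 1) (a :: b :: l) = (s k a + s k b) * listCup s k (b :: l) := rfl

lemma cup_zero_cone_cone (a b : V) (c : Chain V) : cup s 0 (cone a (cone b c)) = 0 := by
  have : cup s 0 ∘ₗ cone a ∘ₗ cone b = 0 := chain_hom_ext fun l => by simp
  exact LinearMap.congr_fun this c

lemma cup_succ_cone_cone (k : ℕ) (a b : V) (c : Chain V) :
    cup s (k + 1) (cone a (cone b c)) = (s k a + s k b) * cup s k (cone b c) := by
  have : cup s (k + 1) ∘ₗ cone a ∘ₗ cone b = (s k a + s k b) • (cup s k ∘ₗ cone b) :=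
    chain_hom_ext fun l => by simp
  exact LinearMap.congr_fun this c

lemma halfCup_cone (k : ℕ) (a : V) (c : Chain V) :
    halfCup s k (cone a c) = s k a * cup s k (cone a c) := by
  have : halfCup s k ∘ₗ cone a = s k a • (cup s k ∘ₗ cone a) :=
    chain_hom_ext fun l => by simp [listHalfCup]
  exact LinearMap.congr_fun this c

/-- The cup product of coboundaries is a cocycle. -/
lemma cup_listBoundary (k : ℕ) (l : List V) : cup s k (listBoundary l) = 0 := by
  induction k generalizing l with
  | zero =>
    match l with
    | [] => simp [listBoundary]
    | [a] => simp [listBoundary]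
    | [a, b] => simp [listBoundary]; decide
    | a :: b :: c :: l => simp [listBoundary, cup_zero_cone_cone]
  | succ k ih =>
    match l with
    | [] => simp [listBoundary]
    | [a] => simp [listBoundary]
    | [a, b] => simp [listBoundary]
    | a :: b :: c :: l =>
      have h := ih (b :: c :: l)
      simp only [listBoundary, map_add, cone_single, cup_single, cup_succ_cone_cone,
        listCup_succ_cons_cons] at h ⊢
      have hc : s k c + s k c = 0 := CharTwo.add_self_eq_zero _
      linear_combination (s k a + s k b) * h + listCup s k (c :: l) * hc

lemma halfCup_boundary (k : ℕ) (c : Chain V) : halfCup s k (boundary c) = cup s (k + 1) c := by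
  have : halfCup s k ∘ₗ boundary = cup s (k + 1) := by
    refine chain_hom_ext fun l => ?_
    simp only [LinearMap.comp_apply, boundary_single, cup_single]
    match l with
    | [] => simp [listBoundary]
    | [a] => simp [listBoundary, listHalfCup]
    | a :: b :: l =>
      have h := cup_listBoundary s k (a :: b :: l)
      simp only [listBoundary, map_add, cone_single, cup_single, halfCup_cone, halfCup_single,
        listHalfCup, listCup_succ_cons_cons] at h ⊢
      have h2 : listCup s k (b :: l) + listCup s k (b :: l) = 0 := CharTwo.add_self_eq_zero _
      linear_combination s k a * h - s k a * h2
  exact LinearMap.congr_fun this c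

lemma exists_ne_of_listCup_ne_zero {k : ℕ} {l : List V} (h : listCup s k l ≠ 0) :
    ∀ i < k, ∃ x ∈ l, ∃ y ∈ l, s i x ≠ s i y := by
  induction k generalizing l with
  | zero => simp
  | succ k ih =>
    match l with
    | [] => simp at h
    | [a] => simp at h
    | a :: b :: l =>
      rw [listCup_succ_cons_cons] at h
      intro i hi
      rcases Nat.lt_succ_iff_lt_or_eq.mp hi with hi | rfl
      · obtain ⟨x, hx, y, hy, hxy⟩ := ih (right_ne_zero_of_mul h) i hi
        exact ⟨x, List.mem_cons_of_mem _ hx, y, List.mem_cons_of_mem _ hy, hxy⟩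
      · refine ⟨a, by simp, b, by simp, fun hab => left_ne_zero_of_mul h ?_⟩
        rw [hab, CharTwo.add_self_eq_zero]

end Cochains

section Odd

variable {V : Type*} [AddCommGroup V] {s : ℕ → V → ZMod 2}

lemma listCup_map_neg (hs : ∀ i x, x ≠ 0 → s i (-x) = s i x + 1)
    (k : ℕ) {l : List V} (hl : ∀ x ∈ l, x ≠ 0) :
    listCup s k (l.map Neg.neg) = listCup s k l := by
  induction k generalizing l with
  | zero =>
    match l with
    | [] => rfl
    | [a] => rfl
    | a :: b :: l => rfl
  | succ k ih =>
    match l with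
    | [] => rfl
    | [a] => rfl
    | a :: b :: l =>
      have h := ih (l := b :: l) fun x hx => hl x (List.mem_cons_of_mem _ hx)
      simp only [List.map_cons, listCup_succ_cons_cons] at h ⊢
      rw [h, hs k a (hl a (by simp)), hs k b (hl b (by simp))]
      have h1 : (1 + 1 : ZMod 2) = 0 := rfl
      linear_combination listCup s k (b :: l) * h1

lemma halfCup_add_antipode (hs : ∀ i x, x ≠ 0 → s i (-x) = s i x + 1)
    (k : ℕ) {c : Chain V}
    (hc : c ∈ Finsupp.supported (ZMod 2) (ZMod 2) {l : List V | ∀ x ∈ l, x ≠ 0}) :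
    halfCup s k (c + antipode c) = cup s k c := by
  have key := map_mem_of_supported (f := halfCup s k + halfCup s k ∘ₗ antipode - cup s k)
    (Q := ⊥) (fun l hl => ?_) hc
  · simpa [sub_eq_zero] using key
  · match l with
    | [] => simp [listHalfCup]
    | a :: l =>
      have h := listCup_map_neg hs k hl
      have h1 : s k a + s k a = 0 := CharTwo.add_self_eq_zero _
      simp only [List.map_cons] at h
      simp only [LinearMap.sub_apply, LinearMap.add_apply, LinearMap.comp_apply, antipode_single,
        halfCup_single, cup_single, listHalfCup, List.map_cons, Submodule.mem_bot, h,
        hs k a (hl a (by simp))]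
      linear_combination listCup s k (a :: l) * h1

/-- A sequence of hemisphere chains contains a simplex on which each of the first `d` sign
functions changes. -/
lemma exists_simplex_of_hemispheres (hs : ∀ i x, x ≠ 0 → s i (-x) = s i x + 1)
    {d : ℕ} {c : ℕ → Chain V} {v : V}
    (h0 : c 0 = Finsupp.single [v] 1)
    (hsucc : ∀ k < d, boundary (c (k + 1)) = c k + antipode (c k))
    (hne : ∀ k ≤ d, c k ∈ Finsupp.supported (ZMod 2) (ZMod 2) {l : List V | ∀ x ∈ l, x ≠ 0}) :
    ∃ l ∈ (c d).support, ∀ i < d, ∃ x ∈ l, ∃ y ∈ l, s i x ≠ s i y := by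
  have key : ∀ k ≤ d, cup s k (c k) = 1 := by
    intro k hk
    induction k with
    | zero => simp [h0]
    | succ k ih =>
      rw [← halfCup_boundary, hsucc k hk, halfCup_add_antipode hs k (hne k (by omega)),
        ih (by omega)]
  have hd := key d le_rfl
  rw [cup, Finsupp.linearCombination_apply, Finsupp.sum] at hd
  obtain ⟨l, hl, hl'⟩ := Finset.exists_ne_zero_of_sum_ne_zero (hd.trans_ne one_ne_zero)
  exact ⟨l, hl, exists_ne_of_listCup_ne_zero s (right_ne_zero_of_mul hl')⟩

end Odd

section Subdivision

variable {V : Type*} [NormedAddCommGroup V] [NormedSpace ℝ V]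

/-- The barycenter of a list of points. -/
noncomputable def barycenter (l : List V) : V := (l.length : ℝ)⁻¹ • l.sum

/-- Barycentric subdivision of chains of lists of length `n`. -/
noncomputable def subdivide : ℕ → Chain V →ₗ[ZMod 2] Chain V
  | 0 => LinearMap.id
  | n + 1 => Finsupp.linearCombination (ZMod 2) fun l =>
      cone (barycenter l) (subdivide n (listBoundary l))

@[simp] lemma subdivide_succ_single (n : ℕ) (l : List V) :
    subdivide (n + 1) (Finsupp.single l 1) =
      cone (barycenter l) (subdivide n (listBoundary l)) := by
  simp [subdivide]

lemma boundary_subdivide (n : ℕ) (c : Chain V) :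
    boundary (subdivide (n + 1) c) = subdivide n (boundary c) := by
  induction n generalizing c with
  | zero =>
    have : boundary ∘ₗ subdivide 1 = subdivide 0 ∘ₗ (boundary : Chain V →ₗ[ZMod 2] Chain V) :=
      chain_hom_ext fun l => by
        simp [boundary_cone, subdivide, boundary_listBoundary]
    exact LinearMap.congr_fun this c
  | succ n ih =>
    have : boundary ∘ₗ subdivide (n + 2) =
        subdivide (n + 1) ∘ₗ (boundary : Chain V →ₗ[ZMod 2] Chain V) :=
      chain_hom_ext fun l => by
        simp [boundary_cone, ih, boundary_listBoundary]
    exact LinearMap.congr_fun this c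

lemma barycenter_map_neg (l : List V) : barycenter (l.map Neg.neg) = -barycenter l := by
  have : (l.map Neg.neg).sum = -l.sum := by
    induction l with
    | nil => simp
    | cons a l ih => simp [ih, add_comm]
  simp [barycenter, this]

lemma antipode_subdivide (n : ℕ) (c : Chain V) :
    antipode (subdivide n c) = subdivide n (antipode c) := by
  induction n generalizing c with
  | zero => rfl
  | succ n ih =>
    have : antipode ∘ₗ subdivide (n + 1) =
        subdivide (n + 1) ∘ₗ (antipode : Chain V →ₗ[ZMod 2] Chain V) :=
      chain_hom_ext fun l => by
        simp [antipode_cone, ih, antipode_listBoundary, barycenter_map_neg]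
    exact LinearMap.congr_fun this c

lemma boundary_subdivide_pow (n m : ℕ) (c : Chain V) :
    boundary ((subdivide (n + 1) ^ m) c) = (subdivide n ^ m) (boundary c) := by
  induction m with
  | zero => simp
  | succ m ih => simp only [pow_succ', Module.End.mul_apply, boundary_subdivide, ih]

lemma antipode_subdivide_pow (n m : ℕ) (c : Chain V) :
    antipode ((subdivide n ^ m) c) = (subdivide n ^ m) (antipode c) := by
  induction m with
  | zero => simp
  | succ m ih => simp only [pow_succ', Module.End.mul_apply, antipode_subdivide, ih]

lemma subdivide_pow_single_singleton (v : V) (m : ℕ) :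
    (subdivide 1 ^ m) (Finsupp.single [v] 1) = Finsupp.single [v] 1 := by
  induction m with
  | zero => simp
  | succ m ih =>
    rw [pow_succ', Module.End.mul_apply, ih, subdivide_succ_single]
    simp [listBoundary, subdivide, barycenter]

lemma barycenter_mem {S : Set V} (hS : Convex ℝ S) {l : List V} (hl : l ≠ [])
    (h : ∀ x ∈ l, x ∈ S) : barycenter l ∈ S := by
  have hpos : (0 : ℝ) < l.length := by
    exact_mod_cast List.length_pos_iff.mpr hl
  have : barycenter l = ∑ i : Fin l.length, (l.length : ℝ)⁻¹ • l[i] := by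
    rw [← Finset.smul_sum, barycenter]
    congr 1
    simp
  rw [this]
  refine hS.sum_mem (fun i _ => by positivity) ?_ fun i _ => h _ (by simp)
  simp [hpos.ne']

lemma norm_sum_sub_le {D : ℝ} (v : V) (l : List V) (h : ∀ x ∈ l, dist x v ≤ D) :
    ‖l.sum - (l.length : ℝ) • v‖ ≤ l.length * D := by
  induction l with
  | nil => simp
  | cons a l ih =>
    have h1 := ih fun x hx => h x (List.mem_cons_of_mem _ hx)
    have h2 := h a (by simp)
    rw [dist_eq_norm] at h2
    calc ‖(a :: l).sum - ((a :: l).length : ℝ) • v‖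
        = ‖(a - v) + (l.sum - (l.length : ℝ) • v)‖ := by
          congr 1; simp only [List.sum_cons, List.length_cons]; push_cast; module
      _ ≤ ‖a - v‖ + ‖l.sum - (l.length : ℝ) • v‖ := norm_add_le _ _
      _ ≤ ((a :: l).length : ℝ) * D := by
          simp only [List.length_cons]; push_cast; linarith

lemma dist_barycenter_le {D : ℝ} {N : ℕ} {l : List V} (hN : l.length ≤ N + 1)
    (hD : ∀ x ∈ l, ∀ y ∈ l, dist x y ≤ D) {v : V} (hv : v ∈ l) :
    dist v (barycenter l) ≤ N / (N + 1) * D := by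
  classical
  have hD0 : 0 ≤ D := dist_nonneg.trans (hD v hv v hv)
  have hperm := List.perm_cons_erase hv
  have hlen : l.length = (l.erase v).length + 1 := by simpa using hperm.length_eq
  have hsum : l.sum = v + (l.erase v).sum := by simpa using hperm.sum_eq
  have h := norm_sum_sub_le v (l.erase v) fun x hx => hD x (List.mem_of_mem_erase hx) v hv
  set n := (l.erase v).length with hn
  have hnN : (n : ℝ) ≤ N := by exact_mod_cast (by omega : n ≤ N)
  have hn0 : (0 : ℝ) < (n : ℝ) + 1 := by positivity
  have hN0 : (0 : ℝ) < (N : ℝ) + 1 := by positivity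
  have hb : barycenter l - v = ((n : ℝ) + 1)⁻¹ • ((l.erase v).sum - (n : ℝ) • v) := by
    rw [barycenter, hlen, hsum]
    push_cast
    rw [← smul_right_inj hn0.ne', smul_sub, smul_smul, smul_smul, mul_inv_cancel₀ hn0.ne']
    module
  rw [dist_comm, dist_eq_norm, hb, norm_smul, norm_inv, Real.norm_of_nonneg hn0.le]
  calc ((n : ℝ) + 1)⁻¹ * ‖(l.erase v).sum - (n : ℝ) • v‖
      ≤ ((n : ℝ) + 1)⁻¹ * (n * D) := by gcongr
    _ = n / (n + 1) * D := by ring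
    _ ≤ N / (N + 1) * D := by
      gcongr ?_ * D
      rw [div_le_div_iff₀ hn0 hN0]
      linarith

/-- Lists of `n` points of `S` at pairwise distance at most `D`. -/
def smallLists (n : ℕ) (S : Set V) (D : ℝ) : Set (List V) :=
  {l | l.length = n ∧ (∀ x ∈ l, x ∈ S) ∧ ∀ x ∈ l, ∀ y ∈ l, dist x y ≤ D}

lemma subdivide_mem_supported {N : ℕ} {n : ℕ} (hn : n ≤ N + 1) {S : Set V} (hS : Convex ℝ S)
    {D : ℝ} {l : List V} (hl : l ∈ smallLists n S D) : subdivide n (Finsupp.single l 1) ∈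
      Finsupp.supported (ZMod 2) (ZMod 2) (smallLists n S (N / (N + 1) * D)) := by
  induction n generalizing S l with
  | zero =>
    obtain rfl := List.length_eq_zero_iff.mp hl.1
    exact Finsupp.single_mem_supported _ _ ⟨rfl, by simp, by simp⟩
  | succ n ih =>
    obtain ⟨hlen, hlS, hlD⟩ := hl
    have hne : l ≠ [] := by rintro rfl; simp at hlen
    have hbS := barycenter_mem hS hne hlS
    have hD0 : 0 ≤ D := by
      obtain ⟨x, hx⟩ := List.exists_mem_of_ne_nil l hne
      exact dist_nonneg.trans (hlD x hx x hx)
    set S' := S ∩ Metric.closedBall (barycenter l) (N / (N + 1) * D)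
    rw [subdivide_succ_single]
    refine cone_mem_supported (P := smallLists n S' (N / (N + 1) * D)) ?_
      (map_mem_of_supported ?_ (listBoundary_mem_supported l))
    · rintro t ⟨h1, h2, h3⟩
      refine ⟨by simp [h1], ?_, ?_⟩
      · simp only [List.forall_mem_cons]
        exact ⟨hbS, fun x hx => (h2 x hx).1⟩
      · simp only [List.forall_mem_cons]
        refine ⟨⟨by rw [dist_self]; positivity, fun x hx => ?_⟩, fun x hx => ⟨(h2 x hx).2, h3 x hx⟩⟩
        rw [dist_comm]
        exact (h2 x hx).2
    · rintro t ⟨h1, h2⟩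
      refine ih (by omega) (hS.inter (convex_closedBall _ _))
        ⟨by omega, fun x hx => ⟨hlS x (h2 hx), ?_⟩,
        fun x hx y hy => hlD x (h2 hx) y (h2 hy)⟩
      exact dist_barycenter_le (by omega) hlD (h2 hx)

lemma subdivide_pow_mem_supported {N n : ℕ} (hn : n ≤ N + 1) {𝒮 : Set (Set V)}
    (h𝒮 : ∀ S ∈ 𝒮, Convex ℝ S) {D : ℝ} {c : Chain V}
    (hc : c ∈ Finsupp.supported (ZMod 2) (ZMod 2) (⋃ S ∈ 𝒮, smallLists n S D)) (m : ℕ) :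
    (subdivide n ^ m) c ∈ Finsupp.supported (ZMod 2) (ZMod 2)
      (⋃ S ∈ 𝒮, smallLists n S ((N / (N + 1)) ^ m * D)) := by
  induction m with
  | zero => simpa using hc
  | succ m ih =>
    rw [pow_succ' (subdivide n), Module.End.mul_apply]
    refine map_mem_of_supported (fun l hl => ?_) ih
    simp only [Set.mem_iUnion] at hl
    obtain ⟨S, hS, hl⟩ := hl
    have := subdivide_mem_supported hn (h𝒮 S hS) hl
    rw [← mul_assoc, ← pow_succ'] at this
    exact Finsupp.supported_mono (Set.subset_biUnion_of_mem hS) this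

end Subdivision

section Hemispheres

variable {V : Type*} [NormedAddCommGroup V] [InnerProductSpace ℝ V]

open scoped InnerProductSpace

/-- The part of the unit ball in the hyperplane dual to `s` and orthogonal to all `e j`
with `k < j`. -/
def cell (e : ℕ → V) (k : ℕ) (s : V) : Set V :=
  {x | ‖x‖ ≤ 1 ∧ ⟪s, x⟫_ℝ = 1 ∧ ∀ j > k, ⟪e j, x⟫_ℝ = 0}

/-- The cells whose dual vector `s` has norm at most `k + 1` and is orthogonal to all `e j`
with `k < j`. -/
def cells (e : ℕ → V) (k : ℕ) : Set (Set V) :=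
  {S | ∃ s : V, ‖s‖ ≤ k + 1 ∧ (∀ j > k, ⟪e j, s⟫_ℝ = 0) ∧ S = cell e k s}

lemma convex_cell (e : ℕ → V) (k : ℕ) (s : V) : Convex ℝ (cell e k s) := by
  rintro x ⟨hx1, hx2, hx3⟩ y ⟨hy1, hy2, hy3⟩ a b ha hb hab
  refine ⟨?_, ?_, fun j hj => ?_⟩
  · calc ‖a • x + b • y‖ ≤ ‖a • x‖ + ‖b • y‖ := norm_add_le _ _
      _ = a * ‖x‖ + b * ‖y‖ := by
        rw [norm_smul, norm_smul, Real.norm_of_nonneg ha, Real.norm_of_nonneg hb]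
      _ ≤ 1 := by nlinarith
  · simp [inner_add_right, inner_smul_right, hx2, hy2, hab]
  · simp [inner_add_right, inner_smul_right, hx3 j hj, hy3 j hj]

lemma hemisphere_mem_supported {e : ℕ → V} {d : ℕ} (hn : ∀ i ≤ d, ‖e i‖ = 1)
    (ho : ∀ i j, i ≠ j → ⟪e i, e j⟫_ℝ = 0) {k : ℕ} (hk : k ≤ d) :
    hemisphere e k ∈ Finsupp.supported (ZMod 2) (ZMod 2)
      (⋃ S ∈ cells e k, smallLists (k + 1) S 2) := by
  have hself : ∀ i ≤ d, ⟪e i, e i⟫_ℝ = 1 := fun i hi => by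
    rw [real_inner_self_eq_norm_sq, hn i hi, one_pow]
  have hsmall : ∀ {k : ℕ} {s : V} {l : List V}, l.length = k + 1 → (∀ x ∈ l, x ∈ cell e k s) →
      l ∈ smallLists (k + 1) (cell e k s) 2 := by
    refine fun h1 h2 => ⟨h1, h2, fun x hx y hy => ?_⟩
    linarith [dist_le_norm_add_norm x y, (h2 x hx).1, (h2 y hy).1]
  induction k with
  | zero =>
    refine Finsupp.single_mem_supported _ _ ?_
    simp only [Set.mem_iUnion]
    refine ⟨cell e 0 (e 0), ⟨e 0, by simp [hn 0 hk], fun j hj => ho j 0 (by omega), rfl⟩,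
      hsmall rfl ?_⟩
    simp only [List.mem_singleton, forall_eq]
    exact ⟨(hn 0 hk).le, hself 0 hk, fun j hj => ho j 0 (by omega)⟩
  | succ k ih =>
    have ih := ih (by omega)
    have hanti : antipode (hemisphere e k) ∈ Finsupp.supported (ZMod 2) (ZMod 2)
        (⋃ S ∈ cells e k, smallLists (k + 1) S 2) := by
      refine map_mem_of_supported (fun l hl => ?_) ih
      rw [antipode_single]
      refine Finsupp.single_mem_supported _ _ ?_
      simp only [Set.mem_iUnion] at hl ⊢
      obtain ⟨_, ⟨s, hs1, hs2, rfl⟩, hl1, hl2, -⟩ := hl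
      refine ⟨cell e k (-s), ⟨-s, by simpa using hs1, fun j hj => by simp [hs2 j hj], rfl⟩,
        hsmall (by simpa using hl1) ?_⟩
      simp only [List.forall_mem_map]
      intro x hx
      obtain ⟨h1, h2, h3⟩ := hl2 x hx
      exact ⟨by simpa using h1, by simpa using h2, fun j hj => by simp [h3 j hj]⟩
    refine cone_mem_supported (fun l hl => ?_) (add_mem ih hanti)
    simp only [Set.mem_iUnion] at hl ⊢
    obtain ⟨_, ⟨s, hs1, hs2, rfl⟩, hl1, hl2, -⟩ := hl
    refine ⟨cell e (k + 1) (s + e (k + 1)), ⟨s + e (k + 1), ?_, fun j hj => ?_, rfl⟩,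
      hsmall (by simp [hl1]) ?_⟩
    · calc ‖s + e (k + 1)‖ ≤ ‖s‖ + ‖e (k + 1)‖ := norm_add_le _ _
        _ ≤ ((k + 1 : ℕ) : ℝ) + 1 := by rw [hn _ hk]; push_cast; linarith
    · rw [inner_add_right, hs2 j (by omega), ho j _ (by omega), add_zero]
    · simp only [List.forall_mem_cons]
      refine ⟨⟨(hn _ hk).le, ?_, fun j hj => ho j _ (by omega)⟩, fun x hx => ?_⟩
      · rw [inner_add_left, hself _ hk, real_inner_comm, hs2 _ (by omega), zero_add]
      · obtain ⟨h1, h2, h3⟩ := hl2 x hx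
        refine ⟨h1, ?_, fun j hj => h3 j (by omega)⟩
        rw [inner_add_left, h2, h3 _ (by omega), add_zero]

/-- For odd sign functions `s 0, …, s (d - 1)` there are arbitrarily small sets of points of the
unit ball, at distance at least `1 / (d + 1)` from the origin, on which every sign changes. -/
lemma exists_small_list {d : ℕ} {e : ℕ → V} (hn : ∀ i ≤ d, ‖e i‖ = 1)
    (ho : ∀ i j, i ≠ j → ⟪e i, e j⟫_ℝ = 0) {s : ℕ → V → ZMod 2}
    (hs : ∀ i x, x ≠ 0 → s i (-x) = s i x + 1) {ε : ℝ} (hε : 0 < ε) :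
    ∃ l : List V, l ≠ [] ∧ (∀ x ∈ l, ‖x‖ ≤ 1 ∧ 1 ≤ (d + 1) * ‖x‖) ∧
      (∀ x ∈ l, ∀ y ∈ l, dist x y < ε) ∧ ∀ i < d, ∃ x ∈ l, ∃ y ∈ l, s i x ≠ s i y := by
  have hρ : (d / (d + 1) : ℝ) < 1 := by rw [div_lt_one (by positivity)]; linarith
  obtain ⟨m, hm⟩ := exists_pow_lt_of_lt_one (half_pos hε) hρ
  have hmem : ∀ k ≤ d, (subdivide (k + 1) ^ m) (hemisphere e k) ∈
      Finsupp.supported (ZMod 2) (ZMod 2)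
        (⋃ S ∈ cells e k, smallLists (k + 1) S ((d / (d + 1)) ^ m * 2)) := fun k hk =>
    subdivide_pow_mem_supported (by omega)
      (by rintro _ ⟨s, -, -, rfl⟩; exact convex_cell e k s) (hemisphere_mem_supported hn ho hk) m
  obtain ⟨l, hl, hls⟩ := exists_simplex_of_hemispheres hs (d := d)
    (c := fun k => (subdivide (k + 1) ^ m) (hemisphere e k))
    (subdivide_pow_single_singleton (e 0) m)
    (fun k _ => by
      rw [boundary_subdivide_pow, boundary_hemisphere, map_add, antipode_subdivide_pow])
    (fun k hk => by
      refine Finsupp.supported_mono (fun l hl => ?_) (hmem k hk)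
      simp only [Set.mem_iUnion] at hl
      obtain ⟨_, ⟨s, -, -, rfl⟩, -, hl, -⟩ := hl
      rintro x hx rfl
      simpa using (hl 0 hx).2.1)
  have hl' := (Finsupp.mem_supported _ _).mp (hmem d le_rfl) hl
  simp only [Set.mem_iUnion] at hl'
  obtain ⟨_, ⟨s, hs, -, rfl⟩, h1, h2, h3⟩ := hl'
  refine ⟨l, by rintro rfl; simp at h1, fun x hx => ⟨(h2 x hx).1, ?_⟩,
    fun x hx y hy => (h3 x hx y hy).trans_lt (by linarith), hls⟩
  calc 1 = ⟪s, x⟫_ℝ := (h2 x hx).2.1.symm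
    _ ≤ ‖s‖ * ‖x‖ := real_inner_le_norm _ _
    _ ≤ (d + 1) * ‖x‖ := by gcongr

end Hemispheres

/-- An odd two-valued function on a real vector space whose values `0` and `1` refine the weak
sign of `g`. -/
lemma exists_odd_sign {n : ℕ} {g : EuclideanSpace ℝ (Fin n) → ℝ} (hg : ∀ x, g (-x) = -g x) :
    ∃ s : EuclideanSpace ℝ (Fin n) → ZMod 2, (∀ x, x ≠ 0 → s (-x) = s x + 1) ∧
      ∀ x, (s x = 0 → g x ≤ 0) ∧ (s x ≠ 0 → 0 ≤ g x) := by
  classical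
  let p : EuclideanSpace ℝ (Fin n) → Prop := fun x => 0 < g x ∨ g x = 0 ∧ 0 < toLex x.ofLp
  have hp : ∀ x, x ≠ 0 → (p (-x) ↔ ¬ p x) := by
    intro x hx
    have hx' : toLex x.ofLp ≠ 0 := fun h => hx <| by
      ext i
      exact congrFun (congrArg ofLex h) i
    have hneg : toLex (-x).ofLp = -toLex x.ofLp := rfl
    simp only [p, hg, hneg, neg_pos, neg_eq_zero]
    rcases lt_trichotomy (g x) 0 with h | h | h
    · simp [h, h.ne, h.not_gt]
    · simp only [h, lt_irrefl, false_or, true_and]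
      exact ⟨lt_asymm, fun h => (lt_or_gt_of_ne hx').resolve_right h⟩
    · simp [h, h.ne', h.not_gt]
  refine ⟨fun x => if p x then 1 else 0, fun x hx => ?_, fun x => ⟨fun h => ?_, fun h => ?_⟩⟩
  · by_cases h : p x
    · have : ¬ p (-x) := by simp [hp x hx, h]
      simp only [h, this, if_true, if_false]; decide
    · have : p (-x) := by simp [hp x hx, h]
      simp only [h, this, if_true, if_false]; decide
  · have : ¬ p x := fun hpx => by simp [hpx] at h
    exact not_lt.mp fun h0 => this (Or.inl h0)
  · have : p x := by by_contra hpx; simp [hpx] at h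
    exact this.elim le_of_lt fun h => h.1.ge

/-- The zero theorem for odd maps, homogeneous form: an odd map to `ℝ^d` that is continuous
away from the origin of `ℝ^(d+1)` has a nontrivial zero. -/
lemma exists_ne_zero_map_eq_zero {d : ℕ} {g : EuclideanSpace ℝ (Fin (d + 1)) → Fin d → ℝ}
    (hc : ContinuousOn g {0}ᶜ) (hodd : ∀ x, g (-x) = -g x) : ∃ x, x ≠ 0 ∧ g x = 0 := by
  by_contra! hne
  set A : Set (EuclideanSpace ℝ (Fin (d + 1))) :=
    Metric.closedBall 0 1 ∩ {x | 1 ≤ (d + 1) * ‖x‖}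
  have hA0 : A ⊆ {0}ᶜ := by
    rintro x ⟨-, hx⟩ rfl
    norm_num at hx
  have hcompact : IsCompact A := (isCompact_closedBall 0 1).inter_right
    (isClosed_le continuous_const (by fun_prop))
  have hcA : ContinuousOn g A := hc.mono hA0
  obtain ⟨η, hη, hηA⟩ : ∃ η > 0, ∀ x ∈ A, η ≤ ‖g x‖ :=
    hcompact.exists_forall_le' hcA.norm (a := 0) fun x hx => norm_pos_iff.mpr (hne x (hA0 hx))
  obtain ⟨δ, hδ, hδA⟩ := Metric.uniformContinuousOn_iff.mp
    (hcompact.uniformContinuousOn_of_continuous hcA) η hη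
  have hsign : ∀ i : ℕ, ∃ s : EuclideanSpace ℝ (Fin (d + 1)) → ZMod 2,
      (∀ x, x ≠ 0 → s (-x) = s x + 1) ∧ ∀ h : i < d,
        ∀ x, (s x = 0 → g x ⟨i, h⟩ ≤ 0) ∧ (s x ≠ 0 → 0 ≤ g x ⟨i, h⟩) := by
    intro i
    by_cases h : i < d
    · obtain ⟨s, h1, h2⟩ := exists_odd_sign (g := fun x => g x ⟨i, h⟩) fun x => by simp [hodd]
      exact ⟨s, h1, fun _ => h2⟩
    · obtain ⟨s, h1, -⟩ := exists_odd_sign (n := d + 1) (g := fun _ => 0) fun x => by simp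
      exact ⟨s, h1, fun h' => absurd h' h⟩
  choose s hs1 hs2 using hsign
  let e : ℕ → EuclideanSpace ℝ (Fin (d + 1)) := fun i =>
    if h : i < d + 1 then EuclideanSpace.single ⟨i, h⟩ 1 else 0
  obtain ⟨l, hl0, hlA, hlδ, hls⟩ := exists_small_list (d := d) (e := e)
    (fun i hi => by simp only [e, dif_pos (Nat.lt_succ_of_le hi)]; simp)
    (fun i j hij => by
      simp only [e]
      split_ifs
      · rw [EuclideanSpace.inner_single_left]
        simp [hij]
      all_goals simp)
    hs1 hδ
  replace hlA : ∀ x ∈ l, x ∈ A := fun x hx => ⟨by simpa using (hlA x hx).1, (hlA x hx).2⟩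
  obtain ⟨z, hz⟩ := List.exists_mem_of_ne_nil l hl0
  refine (hηA z (hlA z hz)).not_gt ((pi_norm_lt_iff hη).mpr fun i => ?_)
  have hclose : ∀ x ∈ l, |g z i - g x i| < η := fun x hx =>
    (dist_le_pi_dist (g z) (g x) i).trans_lt
      (hδA z (hlA z hz) x (hlA x hx) (hlδ z hz x hx))
  obtain ⟨x, hx, y, hy, hxy⟩ := hls i i.2
  obtain ⟨a, ha, ha'⟩ : ∃ a ∈ l, s i a = 0 := by
    by_cases h : s i x = 0
    · exact ⟨x, hx, h⟩
    · refine ⟨y, hy, ?_⟩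
      generalize s i x = u at *
      generalize s i y = w at *
      revert u w; decide
  obtain ⟨b, hb, hb'⟩ : ∃ b ∈ l, s i b ≠ 0 := by
    by_cases h : s i x = 0
    · exact ⟨y, hy, fun h' => hxy (h.trans h'.symm)⟩
    · exact ⟨x, hx, h⟩
  have h1 := (hs2 i i.2 a).1 ha'
  have h2 := (hs2 i i.2 b).2 hb'
  have h3 := abs_lt.mp (hclose a ha)
  have h4 := abs_lt.mp (hclose b hb)
  rw [Real.norm_eq_abs, abs_lt]
  constructor <;> linarith

end BorsukUlam

/-- Borsuk–Ulam theorem: for any continuous map `f : S^d → ℝ^d` there exists a point `x`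
on the sphere with `f x = f (-x)`. -/
theorem stmt_19 (d : ℕ) (hd : 0 < d)
    (f : EuclideanSpace ℝ (Fin (d + 1)) → EuclideanSpace ℝ (Fin d))
    (hf : ContinuousOn f (Metric.sphere (0 : EuclideanSpace ℝ (Fin (d + 1))) 1)) :
    ∃ x ∈ Metric.sphere (0 : EuclideanSpace ℝ (Fin (d + 1))) 1, f x = f (-x) := by
  let u : EuclideanSpace ℝ (Fin (d + 1)) → EuclideanSpace ℝ (Fin (d + 1)) := fun x => ‖x‖⁻¹ • x
  have hu : ∀ x, x ≠ 0 → u x ∈ Metric.sphere (0 : EuclideanSpace ℝ (Fin (d + 1))) 1 :=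
    fun x hx => by simp [u, norm_smul, hx]
  have hu' : ∀ x, x ≠ 0 → -u x ∈ Metric.sphere (0 : EuclideanSpace ℝ (Fin (d + 1))) 1 :=
    fun x hx => by simpa using hu x hx
  have huc : ContinuousOn u {0}ᶜ :=
    (continuous_norm.continuousOn.inv₀ fun x hx => by simpa using hx).smul continuousOn_id
  obtain ⟨x, hx, hgx⟩ := BorsukUlam.exists_ne_zero_map_eq_zero (d := d)
    (g := fun x => (f (u x) - f (-u x)).ofLp)
    ((PiLp.continuous_ofLp 2 _).comp_continuousOn
      ((hf.comp huc hu).sub (hf.comp huc.neg hu')))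
    (fun x => by
      have : u (-x) = -u x := by simp [u]
      simp [this])
  refine ⟨u x, hu x hx, sub_eq_zero.mp ?_⟩
  ext i
  exact congrFun hgx i
end
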